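/- There exist constants ε > 0, C > 0, and N_0 such that for all integers N > N_0, every subset S ⊆ {1, 2, ..., N} containing no three-term arithmetic progression satisfies |S| ≤ C · N · (log N)^{−1−ε}. -/

import Mathlib

set_option linter.unusedSectionVars false

namespace KelleyMeka

open Finset

section Physical

variable {G : Type*} [AddCommGroup G] [Fintype G] [DecidableEq G]

/-- The real-valued indicator function of a finite set. -/
def ind (A : Finset G) (x : G) : ℝ := if x ∈ A then 1 else 0

lemma ind_nonneg (A : Finset G) (x : G) : 0 ≤ ind A x := by
  unfold ind; split_ifs <;> norm_num

lemma ind_le_one (A : Finset G) (x : G) : ind A x ≤ 1 := by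
  unfold ind; split_ifs <;> norm_num

lemma sum_ind (A : Finset G) : ∑ x, ind A x = #A := by
  simp [ind]

/-- Convolution with respect to counting measure. -/
def conv (f g : G → ℝ) (x : G) : ℝ := ∑ s, f s * g (x - s)

/-- Difference convolution with respect to counting measure. -/
def corr (f g : G → ℝ) (x : G) : ℝ := ∑ s, f s * g (s + x)

lemma sum_weight_pow (c a b : G → G → ℝ) (W : Finset G) (k : ℕ) :
    ∑ s : Fin k → G, ∑ w ∈ W, ∑ w' ∈ W, c w w' * ((∏ i, a (s i) w) * ∏ i, b (s i) w') =
      ∑ w ∈ W, ∑ w' ∈ W, c w w' * (∑ s, a s w * b s w') ^ k := by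
  rw [sum_comm]
  refine sum_congr rfl fun w _ => ?_
  rw [sum_comm]
  refine sum_congr rfl fun w' _ => ?_
  rw [← mul_sum, Fintype.sum_pow]
  simp_rw [prod_mul_distrib]

lemma sum_sum_pow (a b : G → G → ℝ) (W : Finset G) (k : ℕ) :
    ∑ w ∈ W, ∑ w' ∈ W, (∑ s, a s w * b s w') ^ k =
      ∑ s : Fin k → G, (∑ w ∈ W, ∏ i, a (s i) w) * ∑ w' ∈ W, ∏ i, b (s i) w' := by
  have := sum_weight_pow (fun _ _ => 1) a b W k
  simp only [one_mul] at this
  rw [← this]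
  refine sum_congr rfl fun s _ => ?_
  rw [sum_mul_sum]

lemma corr_sub (f g : G → ℝ) (w w' : G) :
    corr f g (w - w') = ∑ s, g (s + w) * f (s + w') := by
  unfold corr
  rw [← Equiv.sum_comp (Equiv.addRight w')]
  refine sum_congr rfl fun s _ => ?_
  simp only [Equiv.coe_addRight]
  rw [mul_comm]; congr 2; abel

lemma conv_add_sub (f g : G → ℝ) (t w w' : G) :
    conv f g (t + w - w') = ∑ s, f (s + w) * g (t - s - w') := by
  unfold conv
  rw [← Equiv.sum_comp (Equiv.addRight w)]
  refine sum_congr rfl fun s _ => ?_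
  simp only [Equiv.coe_addRight]
  congr 2; abel

lemma sum_corr_pow (g : G → ℝ) (W : Finset G) (k : ℕ) :
    ∑ w ∈ W, ∑ w' ∈ W, corr g g (w - w') ^ k =
      ∑ s : Fin k → G, (∑ w ∈ W, ∏ i, g (s i + w)) ^ 2 := by
  simp_rw [corr_sub, sum_sum_pow (fun s w => g (s + w)) (fun s w => g (s + w)), sq]

lemma sum_corr_pow_nonneg (g : G → ℝ) (W : Finset G) (k : ℕ) :
    0 ≤ ∑ w ∈ W, ∑ w' ∈ W, corr g g (w - w') ^ k := by
  rw [sum_corr_pow]; exact sum_nonneg fun _ _ => sq_nonneg _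

lemma sum_conv_pow_le (g : G → ℝ) (W : Finset G) (hW : ∀ w ∈ W, -w ∈ W) (k : ℕ) (t : G) :
    ∑ w ∈ W, ∑ w' ∈ W, conv g g (t + w - w') ^ k ≤
      ∑ w ∈ W, ∑ w' ∈ W, corr g g (w - w') ^ k := by
  simp_rw [conv_add_sub, sum_sum_pow (fun s w => g (s + w)) (fun s w => g (t - s - w))]
  have h2 : ∑ s : Fin k → G, (∑ w ∈ W, ∏ i, g (t - s i - w)) ^ 2 =
      ∑ s : Fin k → G, (∑ w ∈ W, ∏ i, g (s i + w)) ^ 2 := by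
    rw [← Equiv.sum_comp (Equiv.subLeft (fun _ : Fin k => t))
      (fun s : Fin k → G => (∑ w ∈ W, ∏ i, g (s i + w)) ^ 2)]
    refine sum_congr rfl fun s _ => ?_
    congr 1
    refine sum_bij (fun w _ => -w) (fun w hw => hW w hw) (fun _ _ _ _ h => neg_injective h)
      (fun w hw => ⟨-w, hW w hw, neg_neg w⟩) fun w _ => ?_
    simp [sub_eq_add_neg]
  rw [sum_corr_pow]
  calc _ ≤ ∑ s : Fin k → G, ((∑ w ∈ W, ∏ i, g (s i + w)) ^ 2 +
        (∑ w ∈ W, ∏ i, g (t - s i - w)) ^ 2) / 2 := by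
        refine sum_le_sum fun s _ => ?_
        nlinarith [sq_nonneg ((∑ w ∈ W, ∏ i, g (s i + w)) - ∑ w ∈ W, ∏ i, g (t - s i - w))]
    _ = _ := by
        rw [← sum_div, sum_add_distrib, h2]; ring

lemma seven_pow_le_choose (p : ℕ) : (7 : ℝ) ^ p ≤ (8 * p).choose p := by
  refine le_trans ?_ (Nat.pow_le_choose (α := ℝ) p (8 * p))
  rw [le_div_iff₀ (by positivity)]
  have h1 : ((p.factorial : ℕ) : ℝ) ≤ (p : ℝ) ^ p := by exact_mod_cast Nat.factorial_le_pow p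
  calc (7 : ℝ) ^ p * p.factorial ≤ 7 ^ p * (p : ℝ) ^ p := by gcongr
    _ = (7 * p : ℝ) ^ p := by rw [mul_pow]
    _ ≤ _ := by
      gcongr
      have : 7 * p ≤ 8 * p + 1 - p := by omega
      exact_mod_cast this

/-- Unbalancing: a function with nonnegative moments and a large `p`-th moment has a shift by `1`
with an exponentially large moment. -/
lemma unbalancing {ι : Type*} (s : Finset ι) (F : ι → ℝ) (p : ℕ)
    (hpos : ∀ j, 0 ≤ ∑ i ∈ s, F i ^ j) (h : #s * (1 / 2 : ℝ) ^ p ≤ ∑ i ∈ s, F i ^ p) :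
    #s * (7 / 2 : ℝ) ^ p ≤ ∑ i ∈ s, (1 + F i) ^ (8 * p) := by
  have hexp : ∑ i ∈ s, (1 + F i) ^ (8 * p) =
      ∑ m ∈ range (8 * p + 1), ((8 * p).choose m : ℝ) * ∑ i ∈ s, F i ^ m := by
    simp_rw [add_comm (1 : ℝ), add_pow, one_pow, mul_one, mul_sum]
    rw [sum_comm]
    refine sum_congr rfl fun m _ => sum_congr rfl fun i _ => mul_comm _ _
  rw [hexp]
  calc #s * (7 / 2 : ℝ) ^ p = 7 ^ p * (#s * (1 / 2 : ℝ) ^ p) := by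
        rw [show (7 / 2 : ℝ) = 7 * (1 / 2) by norm_num, mul_pow]; ring
    _ ≤ (8 * p).choose p * ∑ i ∈ s, F i ^ p := by
        refine mul_le_mul (seven_pow_le_choose p) h (by positivity) (by positivity)
    _ ≤ _ := single_le_sum (f := fun m => ((8 * p).choose m : ℝ) * ∑ i ∈ s, F i ^ m)
        (fun m _ => mul_nonneg (by positivity) (hpos m)) (by simp; omega)

lemma moment_of_approx {ι : Type*} (s : Finset ι) (F D : ι → ℝ) (p : ℕ) (hp : 2 ≤ p)
    (hD : ∀ i ∈ s, 0 ≤ D i) (hFD : ∀ i ∈ s, |1 + F i| ≤ D i + 1 / 100)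
    (h : #s * (7 / 2 : ℝ) ^ p ≤ ∑ i ∈ s, (1 + F i) ^ (8 * p)) :
    #s * (9 / 8 : ℝ) ^ (8 * p) ≤ ∑ i ∈ s, D i ^ (8 * p) := by
  have h1 : ∀ i ∈ s, (1 + F i) ^ (8 * p) ≤ 1 + (51 / 50) ^ (8 * p) * D i ^ (8 * p) := by
    intro i hi
    have hev : Even (8 * p) := ⟨4 * p, by ring⟩
    rw [← hev.pow_abs]
    have hD0 := hD i hi
    have h2 : |1 + F i| ^ (8 * p) ≤ (D i + 1 / 100) ^ (8 * p) := by
      gcongr; exact hFD i hi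
    rcases le_total (D i) (1 / 2) with h3 | h3
    · have : (D i + 1 / 100) ^ (8 * p) ≤ 1 := pow_le_one₀ (by linarith) (by linarith)
      have : 0 ≤ (51 / 50 : ℝ) ^ (8 * p) * D i ^ (8 * p) := by positivity
      linarith
    · have : (D i + 1 / 100) ^ (8 * p) ≤ (51 / 50 * D i) ^ (8 * p) := by
        gcongr; linarith
      rw [mul_pow] at this
      linarith
  have h2 := h.trans (sum_le_sum h1)
  rw [sum_add_distrib, ← mul_sum, sum_const, nsmul_eq_mul, mul_one] at h2
  have h3 : 1 + (51 / 50 : ℝ) ^ (8 * p) * (9 / 8) ^ (8 * p) ≤ (7 / 2) ^ p := by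
    rw [← mul_pow, pow_mul]
    obtain ⟨m, rfl⟩ := Nat.exists_eq_add_of_le hp
    have hb : ((51 / 50 * (9 / 8)) ^ 8 : ℝ) ≤ 31 / 10 := by norm_num
    have h4 : (((51 / 50 * (9 / 8)) ^ 8 : ℝ)) ^ (2 + m) ≤ (31 / 10) ^ (2 + m) := by
      exact pow_le_pow_left₀ (by positivity) hb _
    have h5 : (31 / 10 : ℝ) ^ m ≤ (7 / 2) ^ m :=
      pow_le_pow_left₀ (by norm_num) (by norm_num) _
    have h6 : (1 : ℝ) ≤ (7 / 2) ^ m := one_le_pow₀ (by norm_num)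
    rw [pow_add] at h4 ⊢
    rw [pow_add (7 / 2 : ℝ)]
    rw [pow_add (31 / 10 : ℝ)] at h4
    nlinarith
  have h7 : (0 : ℝ) < (51 / 50) ^ (8 * p) := by positivity
  refine le_of_mul_le_mul_left ?_ h7
  have h8 : (0 : ℝ) ≤ #s := by positivity
  nlinarith

/-- Sifting, or dependent random choice: a large moment of `corr (ind A) (ind A)` along `W - W`
produces a
dense subset of `W` almost all of whose differences are popular differences of `A`. -/
lemma sifting (A W : Finset G) (q : ℕ) {H θ δ η : ℝ} (hW : W.Nonempty) (hH : 0 < H)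
    (hδ : 0 < δ) (hη0 : 0 ≤ η) (hM : #W ^ 2 * H ^ q ≤ ∑ w ∈ W, ∑ w' ∈ W, corr (ind A) (ind A) (w - w') ^ q)
    (hθ : θ ^ q ≤ δ * H ^ q) (hη : η * #A ^ q ≤ H ^ q / 2) :
    ∃ A' ⊆ W, A'.Nonempty ∧ η * #W ≤ #A' ∧
      ∑ x ∈ A', ∑ y ∈ A', (if corr (ind A) (ind A) (x - y) < θ then (1 : ℝ) else 0) ≤
        3 * δ * #A' ^ 2 := by
  have hcorr : ∀ x, 0 ≤ corr (ind A) (ind A) x := fun x =>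
    sum_nonneg fun _ _ => mul_nonneg (ind_nonneg _ _) (ind_nonneg _ _)
  let a : G → G → ℝ := fun s w => ind A (s + w)
  let As : (Fin q → G) → Finset G := fun s => W.filter fun w => ∀ i, s i + w ∈ A
  have hprod : ∀ (s : Fin q → G) w, ∏ i, a (s i) w = if ∀ i, s i + w ∈ A then 1 else 0 := by
    intro s w
    simp only [a, ind]
    rw [prod_ite_zero]; simp
  have hcard : ∀ s, ∑ w ∈ W, ∏ i, a (s i) w = #(As s) := by
    intro s; simp_rw [hprod]; simp [As]
  have hsq : ∑ s, (#(As s) : ℝ) ^ 2 =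
      ∑ w ∈ W, ∑ w' ∈ W, corr (ind A) (ind A) (w - w') ^ q := by
    rw [sum_corr_pow]
    refine sum_congr rfl fun s _ => ?_
    rw [← hcard]
  have hlin : ∑ s, (#(As s) : ℝ) = #W * #A ^ q := by
    simp_rw [← hcard]
    rw [sum_comm]
    have : ∀ w ∈ W, ∑ s : Fin q → G, ∏ i, a (s i) w = (#A : ℝ) ^ q := by
      intro w _
      rw [← Fintype.sum_pow (fun x => a x w)]
      congr 1
      rw [← sum_ind A, ← Equiv.sum_comp (Equiv.addRight w) (ind A)]
      rfl
    rw [sum_congr rfl this]; simp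
  let c : G → G → ℝ := fun x y => if corr (ind A) (ind A) (x - y) < θ then (1 : ℝ) else 0
  have hbad : ∑ s, ∑ x ∈ As s, ∑ y ∈ As s, c x y ≤ #W ^ 2 * (δ * H ^ q) := by
    have h1 : ∀ s : Fin q → G, ∑ x ∈ As s, ∑ y ∈ As s, c x y =
        ∑ w ∈ W, ∑ w' ∈ W, c w w' * ((∏ i, a (s i) w) * ∏ i, a (s i) w') := by
      intro s
      simp only [As, sum_filter, hprod]
      refine sum_congr rfl fun w _ => ?_
      split_ifs with h
      · refine sum_congr rfl fun w' _ => ?_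
        split_ifs <;> simp
      · simp
    simp_rw [h1]
    rw [sum_weight_pow]
    have h2 : ∀ w ∈ W, ∀ w' ∈ W, c w w' * (∑ s, a s w * a s w') ^ q ≤ δ * H ^ q := by
      intro w _ w' _
      have h3 : ∑ s, a s w * a s w' = corr (ind A) (ind A) (w - w') := 
        (corr_sub (ind A) (ind A) w w').symm
      rw [h3]
      have h0 := hcorr (w - w')
      simp only [c]
      split_ifs with h
      · rw [one_mul]; refine le_trans ?_ hθ; gcongr
      · rw [zero_mul]; positivity
    calc _ ≤ ∑ w ∈ W, ∑ w' ∈ W, δ * H ^ q := sum_le_sum fun w hw => sum_le_sum fun w' hw' =>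
          h2 w hw w' hw'
      _ = _ := by simp; ring
  have hWp : (0 : ℝ) < #W := by exact_mod_cast hW.card_pos
  have hpos : 0 < ∑ s, ((#(As s) : ℝ) ^ 2 - (∑ x ∈ As s, ∑ y ∈ As s, c x y) / (3 * δ)
      - η * #W * #(As s)) := by
    rw [sum_sub_distrib, sum_sub_distrib, ← sum_div, ← mul_sum, hlin, hsq]
    have h1 : (∑ s, ∑ x ∈ As s, ∑ y ∈ As s, c x y) / (3 * δ) ≤ #W ^ 2 * H ^ q / 3 := by
      rw [div_le_iff₀ (by positivity)]; linarith
    have h2 : η * #W * (#W * #A ^ q) ≤ #W ^ 2 * (H ^ q / 2) := by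
      calc _ = (#W : ℝ) ^ 2 * (η * #A ^ q) := by ring
        _ ≤ _ := by gcongr
    have h3 : 0 < (#W : ℝ) ^ 2 * H ^ q := by positivity
    linarith
  obtain ⟨s, -, hs⟩ := exists_lt_of_sum_lt (f := fun _ => (0 : ℝ))
    (lt_of_eq_of_lt sum_const_zero hpos)
  have hb : 0 ≤ (∑ x ∈ As s, ∑ y ∈ As s, c x y) / (3 * δ) := by
    refine div_nonneg (sum_nonneg fun x _ => sum_nonneg fun y _ => ?_) (by positivity)
    simp only [c]; split_ifs <;> norm_num
  have hne : (As s).Nonempty := by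
    by_contra hcon
    rw [not_nonempty_iff_eq_empty] at hcon
    rw [hcon] at hs
    simp at hs
  have hc0 : (0 : ℝ) < #(As s) := by exact_mod_cast hne.card_pos
  refine ⟨As s, filter_subset _ _, hne, ?_, ?_⟩
  · refine le_of_mul_le_mul_right ?_ hc0
    nlinarith
  · by_contra! hcon
    have h1 : (#(As s) : ℝ) ^ 2 < (∑ x ∈ As s, ∑ y ∈ As s, c x y) / (3 * δ) := by
      rw [lt_div_iff₀ (by positivity)]; linarith
    have : 0 ≤ η * #W * #(As s) := by positivity
    linarith

end Physical

lemma card_tail_le {α : Type*} [DecidableEq α] (A : Finset α) (g : α → ℝ)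
    (hg : ∀ a ∈ A, |g a| ≤ 1) (h0 : ∑ a ∈ A, g a = 0) (k : ℕ) {δ : ℝ} (hδ : 0 < δ) :
    (#{x ∈ Fintype.piFinset (fun _ : Fin k => A) | k * δ < ∑ i, g (x i)} : ℝ) ≤
      Real.exp (-(k * δ ^ 2 / 2)) * #A ^ k := by
  have h1 : ∑ a ∈ A, Real.exp (δ * g a) ≤ #A * Real.exp (δ ^ 2 / 2) := by
    calc ∑ a ∈ A, Real.exp (δ * g a) ≤ ∑ a ∈ A, (Real.cosh δ + g a * Real.sinh δ) :=
          sum_le_sum fun a ha => by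
            rw [mul_comm δ]; exact Real.exp_mul_le_cosh_add_mul_sinh (hg a ha) δ
      _ = #A * Real.cosh δ := by rw [sum_add_distrib, ← sum_mul, h0]; simp
      _ ≤ _ := by gcongr; exact Real.cosh_le_exp_half_sq δ
  have h2 : (#{x ∈ Fintype.piFinset (fun _ : Fin k => A) | k * δ < ∑ i, g (x i)} : ℝ) *
      Real.exp (k * δ ^ 2) ≤ (∑ a ∈ A, Real.exp (δ * g a)) ^ k := by
    rw [sum_pow', ← nsmul_eq_mul, ← sum_const]
    refine (sum_le_sum fun x hx => ?_).trans
      (sum_le_sum_of_subset_of_nonneg (filter_subset _ _) fun x _ _ => by positivity)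
    rw [← Real.exp_sum, ← mul_sum]
    refine Real.exp_le_exp.2 ?_
    have := (mem_filter.1 hx).2
    nlinarith
  have h3 : (∑ a ∈ A, Real.exp (δ * g a)) ^ k ≤ #A ^ k * Real.exp (k * δ ^ 2 / 2) := by
    calc _ ≤ (#A * Real.exp (δ ^ 2 / 2)) ^ k :=
          pow_le_pow_left₀ (sum_nonneg fun _ _ => by positivity) h1 _
      _ = _ := by rw [mul_pow, ← Real.exp_nat_mul]; congr 2; ring
  have h4 : Real.exp (k * δ ^ 2) * (Real.exp (-(k * δ ^ 2 / 2)) * #A ^ k) =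
      #A ^ k * Real.exp (k * δ ^ 2 / 2) := by
    rw [← mul_assoc, ← Real.exp_add, mul_comm]; congr 2; ring
  have h5 := Real.exp_pos (k * δ ^ 2)
  refine le_of_mul_le_mul_left ?_ h5
  rw [h4, mul_comm]
  exact h2.trans h3

/-- Hoeffding's inequality for uniform samples from a finite set, in counting form. -/
lemma card_deviation_le {α : Type*} [DecidableEq α] (A : Finset α) (g : α → ℝ)
    (hg : ∀ a ∈ A, |g a| ≤ 1) (h0 : ∑ a ∈ A, g a = 0) (k : ℕ) {δ : ℝ} (hδ : 0 < δ) :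
    (#{x ∈ Fintype.piFinset (fun _ : Fin k => A) | k * δ < |∑ i, g (x i)|} : ℝ) ≤
      2 * Real.exp (-(k * δ ^ 2 / 2)) * #A ^ k := by
  have h1 := card_tail_le A g hg h0 k hδ
  have h2 := card_tail_le A (fun a => -g a) (by simpa using hg) (by simpa using h0) k hδ
  have h3 : #{x ∈ Fintype.piFinset (fun _ : Fin k => A) | k * δ < |∑ i, g (x i)|} ≤
      #{x ∈ Fintype.piFinset (fun _ : Fin k => A) | k * δ < ∑ i, g (x i)} +
      #{x ∈ Fintype.piFinset (fun _ : Fin k => A) | k * δ < ∑ i, -g (x i)} := by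
    refine (card_le_card ?_).trans (card_union_le _ _)
    intro x
    simp only [mem_filter, mem_union, sum_neg_distrib]
    rintro ⟨hx, h⟩
    rcases lt_abs.1 h with h | h
    · exact Or.inl ⟨hx, h⟩
    · exact Or.inr ⟨hx, h⟩
  have h4 : (#{x ∈ Fintype.piFinset (fun _ : Fin k => A) | k * δ < |∑ i, g (x i)|} : ℝ) ≤
      #{x ∈ Fintype.piFinset (fun _ : Fin k => A) | k * δ < ∑ i, g (x i)} +
      #{x ∈ Fintype.piFinset (fun _ : Fin k => A) | k * δ < ∑ i, -g (x i)} := by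
    exact_mod_cast h3
  linarith

section AlmostPeriodicity

variable {G : Type*} [AddCommGroup G] [DecidableEq G]

/-- The average of the translates of `f` by the elements of `A`. -/
noncomputable def avgTranslate (A : Finset G) (f : G → ℝ) (z : G) : ℝ := (∑ x ∈ A, f (x + z)) / #A

lemma avgTranslate_nonneg (A : Finset G) {f : G → ℝ} (hf : ∀ x, 0 ≤ f x) (z : G) :
    0 ≤ avgTranslate A f z :=
  div_nonneg (sum_nonneg fun _ _ => hf _) (by positivity)

lemma avgTranslate_le_one (A : Finset G) {f : G → ℝ} (hf : ∀ x, f x ≤ 1) (z : G) :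
    avgTranslate A f z ≤ 1 := by
  refine div_le_one_of_le₀ ?_ (by positivity)
  calc _ ≤ ∑ x ∈ A, (1 : ℝ) := sum_le_sum fun _ _ => hf _
    _ = _ := by simp

/-- Croot–Sisask almost-periodicity via random sampling. -/
lemma exists_almost_periods (A U Y Z : Finset G) (hA : A.Nonempty) (hU : U.Nonempty)
    (hY : ∀ a ∈ A, ∀ u ∈ U, a + u ∈ Y) (f : G → ℝ) (hf0 : ∀ x, 0 ≤ f x) (hf1 : ∀ x, f x ≤ 1)
    (k : ℕ) (hk : 0 < k) {δ : ℝ} (hδ : 0 < δ) :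
    ∃ T ⊆ U, (#U : ℝ) * #A ^ k ≤ 2 * #T * #Y ^ k ∧ ∃ ψ : G → ℝ, (∀ z, 0 ≤ ψ z) ∧ (∀ z, ψ z ≤ 1) ∧
      ∀ u ∈ T, (#{z ∈ Z | δ < |avgTranslate A f z - ψ (z - u)|} : ℝ) ≤
        4 * Real.exp (-(k * δ ^ 2 / 2)) * #Z := by
  have hA0 : (0 : ℝ) < #A := by exact_mod_cast hA.card_pos
  have hk0 : (0 : ℝ) < k := by exact_mod_cast hk
  set E := Real.exp (-(k * δ ^ 2 / 2)) with hE
  have hE0 : 0 < E := Real.exp_pos _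
  set φ := avgTranslate A f with hφ
  have hφ0 := avgTranslate_nonneg A hf0
  have hφ1 := avgTranslate_le_one A hf1
  let P : Finset (Fin k → G) := Fintype.piFinset fun _ => A
  have hP : (#P : ℝ) = #A ^ k := by simp [P]
  let av : (Fin k → G) → G → ℝ := fun x z => (∑ i, f (x i + z)) / k
  have hav0 : ∀ x z, 0 ≤ av x z := fun x z =>
    div_nonneg (sum_nonneg fun _ _ => hf0 _) hk0.le
  have hav1 : ∀ x z, av x z ≤ 1 := fun x z => by
    refine div_le_one_of_le₀ ?_ hk0.le
    calc _ ≤ ∑ i : Fin k, (1 : ℝ) := sum_le_sum fun _ _ => hf1 _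
      _ = _ := by simp
  have hdev : ∀ z, (#{x ∈ P | δ < |φ z - av x z|} : ℝ) ≤ 2 * E * #P := by
    intro z
    rw [hP]
    refine le_trans ?_ (card_deviation_le A (fun a => f (a + z) - φ z) ?_ ?_ k hδ)
    · refine Nat.cast_le.2 (card_le_card (monotone_filter_right _ fun x _ h => ?_))
      simp only [av] at h
      rw [sum_sub_distrib, sum_const, card_univ, Fintype.card_fin, nsmul_eq_mul, abs_sub_comm]
      have : k * φ z - ∑ i, f (x i + z) = k * (φ z - (∑ i, f (x i + z)) / k) := by
        field_simp
      rw [this, abs_mul, abs_of_pos hk0]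
      gcongr
    · intro a _
      rw [abs_le]
      have := hf0 (a + z); have := hf1 (a + z); have := hφ0 z; have := hφ1 z
      constructor <;> linarith
    · rw [sum_sub_distrib, sum_const, nsmul_eq_mul, hφ, avgTranslate]
      field_simp; ring
  let L := {x ∈ P | (#{z ∈ Z | δ < |φ z - av x z|} : ℝ) ≤ 4 * E * #Z}
  have hL : (#P : ℝ) ≤ 2 * #L := by
    rcases Z.eq_empty_or_nonempty with hZ | hZ
    · have : L = P := by simp [L, hZ]
      rw [this]
      have : (0 : ℝ) ≤ #P := by positivity
      linarith
    have hZ0 : (0 : ℝ) < #Z := by exact_mod_cast hZ.card_pos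
    have hsplit : (#L : ℝ) + #{x ∈ P | ¬ (#{z ∈ Z | δ < |φ z - av x z|} : ℝ) ≤ 4 * E * #Z} = #P := by
      exact_mod_cast card_filter_add_card_filter_not _
    have hm : (#{x ∈ P | ¬ (#{z ∈ Z | δ < |φ z - av x z|} : ℝ) ≤ 4 * E * #Z} : ℝ) * (4 * E * #Z) ≤
        #Z * (2 * E * #P) := by
      calc _ ≤ ∑ x ∈ P with ¬ (#{z ∈ Z | δ < |φ z - av x z|} : ℝ) ≤ 4 * E * #Z,
            (#{z ∈ Z | δ < |φ z - av x z|} : ℝ) := by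
            rw [← nsmul_eq_mul, ← sum_const]
            exact sum_le_sum fun x hx => (not_le.1 (mem_filter.1 hx).2).le
        _ ≤ ∑ x ∈ P, (#{z ∈ Z | δ < |φ z - av x z|} : ℝ) :=
            sum_le_sum_of_subset_of_nonneg (filter_subset _ _) fun _ _ _ => by positivity
        _ = ∑ z ∈ Z, (#{x ∈ P | δ < |φ z - av x z|} : ℝ) := by
            have := sum_card_bipartiteAbove_eq_sum_card_bipartiteBelow (s := P) (t := Z)
              (fun x z => δ < |φ z - av x z|)
            exact_mod_cast this
        _ ≤ ∑ z ∈ Z, 2 * E * #P := sum_le_sum fun z _ => hdev z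
        _ = _ := by simp
    have h5 : 0 < 4 * E * (#Z : ℝ) := by positivity
    have : (#{x ∈ P | ¬ (#{z ∈ Z | δ < |φ z - av x z|} : ℝ) ≤ 4 * E * #Z} : ℝ) ≤ #P / 2 := by
      refine le_of_mul_le_mul_right ?_ h5
      calc _ ≤ _ := hm
        _ = _ := by ring
    linarith
  obtain ⟨u₀, hu₀⟩ := hU
  obtain ⟨a₀, ha₀⟩ := hA
  let Q : Finset (Fin k → G) := Fintype.piFinset fun _ => Y
  have hQ : (#Q : ℝ) = #Y ^ k := by simp [Q]
  have hQne : Q.Nonempty := ⟨fun _ => a₀ + u₀, by simp [Q, hY a₀ ha₀ u₀ hu₀]⟩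
  have hsum : ∑ w ∈ Q, #{u ∈ U | (fun i => w i - u) ∈ L} = #U * #L := by
    have h1 : #(U ×ˢ L) = ∑ w ∈ Q, #{p ∈ U ×ˢ L | (fun i => p.2 i + p.1) = w} := by
      refine card_eq_sum_card_fiberwise fun p hp => ?_
      simp only [coe_product, Set.mem_prod, mem_coe, L, mem_filter, P, Fintype.mem_piFinset] at hp
      simp only [Q, mem_coe, Fintype.mem_piFinset]
      exact fun i => hY _ (hp.2.1 i) _ hp.1
    rw [← card_product, h1]
    refine sum_congr rfl fun w _ => ?_
    refine card_bij (fun u _ => (u, fun i => w i - u)) ?_ ?_ ?_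
    · intro u hu
      simp only [mem_filter, mem_product] at hu ⊢
      exact ⟨hu, by simp⟩
    · intro u _ v _ h
      exact congrArg Prod.fst h
    · rintro ⟨u, x⟩ hp
      simp only [mem_filter, mem_product] at hp
      obtain ⟨⟨hu, hx⟩, rfl⟩ := hp
      exact ⟨u, by simp [hu, hx], by simp⟩
  obtain ⟨w, -, hw⟩ : ∃ w ∈ Q, (#U * #L : ℝ) / #Q ≤ #{u ∈ U | (fun i => w i - u) ∈ L} := by
    refine exists_le_of_sum_le hQne ?_
    have hQ0 : (#Q : ℝ) ≠ 0 := by exact_mod_cast hQne.card_pos.ne'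
    rw [sum_const, nsmul_eq_mul, mul_div_cancel₀ _ hQ0]
    exact_mod_cast hsum.ge
  refine ⟨{u ∈ U | (fun i => w i - u) ∈ L}, filter_subset _ _, ?_, fun z => av w z, hav0 w, hav1 w, ?_⟩
  · have hQ0 : (0 : ℝ) < #Q := by exact_mod_cast hQne.card_pos
    rw [div_le_iff₀ hQ0, hQ] at hw
    rw [← hP]
    have : (0 : ℝ) ≤ #U := by positivity
    nlinarith
  · intro u hu
    have h1 := (mem_filter.1 (mem_filter.1 hu).2).2
    refine le_trans (le_of_eq ?_) h1
    congr 2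
    ext z
    have : ∀ i, w i - u + z = w i + (z - u) := fun i => by abel
    have h2 : av (fun i => w i - u) z = av w (z - u) := by
      change (∑ i, f (w i - u + z)) / (k : ℝ) = (∑ i, f (w i + (z - u))) / k
      simp_rw [this]
    rw [mem_filter, mem_filter, h2]

/-- The average of `f` over the translate of `-A`. -/
noncomputable def smooth (A : Finset G) (f : G → ℝ) (t : G) : ℝ := (∑ y ∈ A, f (t - y)) / #A

lemma smooth_sub_le (A Z : Finset G) (hA : A.Nonempty) (φ ψ : G → ℝ)
    (hφ0 : ∀ x, 0 ≤ φ x) (hφ1 : ∀ x, φ x ≤ 1) (hψ0 : ∀ x, 0 ≤ ψ x) (hψ1 : ∀ x, ψ x ≤ 1)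
    {δ β : ℝ} (hδ : 0 ≤ δ) (u t : G)
    (hbad : (#{z ∈ Z | δ < |φ z - ψ (z - u)|} : ℝ) ≤ β * #A) (ht : ∀ y ∈ A, t - y ∈ Z) :
    |smooth A φ t - (∑ y ∈ A, ψ (t - y - u)) / #A| ≤ δ + β := by
  have hA0 : (0 : ℝ) < #A := by exact_mod_cast hA.card_pos
  unfold smooth
  rw [← sub_div, ← sum_sub_distrib, abs_div, abs_of_pos hA0, div_le_iff₀ hA0]
  calc |∑ y ∈ A, (φ (t - y) - ψ (t - y - u))| ≤ ∑ y ∈ A, |φ (t - y) - ψ (t - y - u)| :=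
        abs_sum_le_sum_abs _ _
    _ ≤ ∑ y ∈ A, (δ + if δ < |φ (t - y) - ψ (t - y - u)| then 1 else 0) := by
        refine sum_le_sum fun y _ => ?_
        split_ifs with h
        · have : |φ (t - y) - ψ (t - y - u)| ≤ 1 := by
            rw [abs_le]
            have := hφ0 (t - y); have := hφ1 (t - y)
            have := hψ0 (t - y - u); have := hψ1 (t - y - u)
            constructor <;> linarith
          linarith
        · linarith
    _ = #A * δ + #{y ∈ A | δ < |φ (t - y) - ψ (t - y - u)|} := by
        rw [sum_add_distrib]; simp
    _ ≤ #A * δ + #{z ∈ Z | δ < |φ z - ψ (z - u)|} := by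
        have : #{y ∈ A | δ < |φ (t - y) - ψ (t - y - u)|} ≤ #{z ∈ Z | δ < |φ z - ψ (z - u)|} := by
          refine card_le_card_of_injOn (fun y => t - y) ?_ fun x _ y _ h => sub_right_injective h
          intro y hy
          simp only [coe_filter, Set.mem_ofPred_eq] at hy ⊢
          exact ⟨ht y hy.1, hy.2⟩
        have : (#{y ∈ A | δ < |φ (t - y) - ψ (t - y - u)|} : ℝ) ≤
          #{z ∈ Z | δ < |φ z - ψ (z - u)|} := by exact_mod_cast this
        linarith
    _ ≤ _ := by linarith

lemma smooth_shift_close (A Z : Finset G) (hA : A.Nonempty) (φ ψ : G → ℝ)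
    (hφ0 : ∀ x, 0 ≤ φ x) (hφ1 : ∀ x, φ x ≤ 1) (hψ0 : ∀ x, 0 ≤ ψ x) (hψ1 : ∀ x, ψ x ≤ 1)
    {δ β : ℝ} (hδ : 0 ≤ δ) (u u' t : G)
    (hu : (#{z ∈ Z | δ < |φ z - ψ (z - u)|} : ℝ) ≤ β * #A)
    (hu' : (#{z ∈ Z | δ < |φ z - ψ (z - u')|} : ℝ) ≤ β * #A)
    (ht : ∀ y ∈ A, t - y ∈ Z) (ht' : ∀ y ∈ A, t + u - u' - y ∈ Z) :
    |smooth A φ (t + u - u') - smooth A φ t| ≤ 2 * (δ + β) := by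
  have h1 := smooth_sub_le A Z hA φ ψ hφ0 hφ1 hψ0 hψ1 hδ u (t + u - u') hu ht'
  have h2 := smooth_sub_le A Z hA φ ψ hφ0 hφ1 hψ0 hψ1 hδ u' t hu' ht
  have h3 : ∀ y, t + u - u' - y - u = t - y - u' := fun y => by abel
  simp_rw [h3] at h1
  rw [abs_le] at *
  constructor <;> linarith [h1.1, h1.2, h2.1, h2.2]

/-- The average of `f` over the translate of `T - T`. -/
noncomputable def avgDiff (T : Finset G) (f : G → ℝ) (t : G) : ℝ :=
  (∑ u ∈ T, ∑ u' ∈ T, f (t + u - u')) / #T ^ 2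

lemma avgDiff_mono (T : Finset G) {f g : G → ℝ} (h : ∀ t, f t ≤ g t) (t : G) :
    avgDiff T f t ≤ avgDiff T g t := by
  unfold avgDiff
  gcongr
  exact h _

lemma avgDiff_iterate_mono (T : Finset G) {f g : G → ℝ} (h : ∀ t, f t ≤ g t) (r : ℕ) (t : G) :
    (avgDiff T)^[r] f t ≤ (avgDiff T)^[r] g t := by
  induction r generalizing t with
  | zero => exact h t
  | succ r ih =>
    rw [Function.iterate_succ_apply', Function.iterate_succ_apply']
    exact avgDiff_mono T ih t

lemma avgDiff_sub_le (T : Finset G) (hT : T.Nonempty) (f : G → ℝ) (t : G) {c e : ℝ}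
    (h : ∀ u ∈ T, ∀ u' ∈ T, |f (t + u - u') - c| ≤ e) : |avgDiff T f t - c| ≤ e := by
  have hT0 : (0 : ℝ) < #T := by exact_mod_cast hT.card_pos
  have h1 : avgDiff T f t - c = (∑ u ∈ T, ∑ u' ∈ T, (f (t + u - u') - c)) / #T ^ 2 := by
    unfold avgDiff
    simp_rw [sum_sub_distrib]
    simp
    field_simp
  rw [h1, abs_div, abs_of_pos (by positivity : (0 : ℝ) < #T ^ 2), div_le_iff₀ (by positivity)]
  calc _ ≤ ∑ u ∈ T, ∑ u' ∈ T, |f (t + u - u') - c| :=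
        (abs_sum_le_sum_abs _ _).trans (sum_le_sum fun _ _ => abs_sum_le_sum_abs _ _)
    _ ≤ ∑ u ∈ T, ∑ u' ∈ T, e := sum_le_sum fun u hu => sum_le_sum fun u' hu' => h u hu u' hu'
    _ = _ := by simp; ring

lemma avgDiff_iterate_close (T : Finset G) (hT : T.Nonempty) (h : G → ℝ) (V : ℕ → Finset G) (r : ℕ)
    (e : ℝ) (hV : ∀ i, ∀ t ∈ V i, ∀ u ∈ T, ∀ u' ∈ T, t + u - u' ∈ V (i + 1))
    (he : ∀ i < r, ∀ t ∈ V i, ∀ u ∈ T, ∀ u' ∈ T, |h (t + u - u') - h t| ≤ e) (j : ℕ) :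
    ∀ i, i + j ≤ r → ∀ t ∈ V i, |(avgDiff T)^[j] h t - h t| ≤ j * e := by
  induction j with
  | zero => intro i _ t _; simp
  | succ j ih =>
    intro i hi t ht
    rw [Function.iterate_succ_apply']
    refine avgDiff_sub_le T hT _ t fun u hu u' hu' => ?_
    have h1 := ih (i + 1) (by omega) _ (hV i t ht u hu u' hu')
    have h2 := he i (by omega) t ht u hu u' hu'
    push_cast
    calc _ ≤ |(avgDiff T)^[j] h (t + u - u') - h (t + u - u')| + |h (t + u - u') - h t| :=
          abs_sub_le _ _ _
      _ ≤ _ := by linarith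

lemma sum_avgDiff_le (T B : Finset G) (hT : T.Nonempty) (f : G → ℝ) {C : ℝ}
    (hC : ∀ z, ∑ t ∈ B, f (z + t) ≤ C) (z : G) : ∑ t ∈ B, avgDiff T f (z + t) ≤ C := by
  have hT0 : (0 : ℝ) < #T := by exact_mod_cast hT.card_pos
  unfold avgDiff
  rw [← sum_div, div_le_iff₀ (by positivity), sum_comm]
  calc _ ≤ ∑ u ∈ T, ∑ u' ∈ T, C := by
        refine sum_le_sum fun u _ => ?_
        rw [sum_comm]
        refine sum_le_sum fun u' _ => ?_
        refine le_trans (le_of_eq ?_) (hC (z + u - u'))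
        refine sum_congr rfl fun t _ => ?_
        congr 1; abel
    _ = _ := by simp; ring

lemma sum_avgDiff_iterate_le (T B : Finset G) (hT : T.Nonempty) (f : G → ℝ) {C : ℝ}
    (hC : ∀ z, ∑ t ∈ B, f (z + t) ≤ C) (r : ℕ) (z : G) :
    ∑ t ∈ B, (avgDiff T)^[r] f (z + t) ≤ C := by
  induction r generalizing z with
  | zero => exact hC z
  | succ r ih =>
    rw [Function.iterate_succ']
    exact sum_avgDiff_le T B hT _ ih z

lemma sum_smooth_le (A B : Finset G) (hA : A.Nonempty) (f : G → ℝ) {C : ℝ}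
    (hC : ∀ z, ∑ t ∈ B, f (z + t) ≤ C) (z : G) : ∑ t ∈ B, smooth A f (z + t) ≤ C := by
  have hA0 : (0 : ℝ) < #A := by exact_mod_cast hA.card_pos
  unfold smooth
  rw [← sum_div, div_le_iff₀ hA0, sum_comm]
  calc _ ≤ ∑ u ∈ A, C := by
        refine sum_le_sum fun u _ => ?_
        refine le_trans (le_of_eq ?_) (hC (z - u))
        refine sum_congr rfl fun t _ => ?_
        congr 1; abel
    _ = _ := by simp; ring

lemma sum_avgTranslate_le (A B : Finset G) (hA : A.Nonempty) (f : G → ℝ) {C : ℝ}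
    (hC : ∀ z, ∑ t ∈ B, f (z + t) ≤ C) (z : G) : ∑ t ∈ B, avgTranslate A f (z + t) ≤ C := by
  have hA0 : (0 : ℝ) < #A := by exact_mod_cast hA.card_pos
  unfold avgTranslate
  rw [← sum_div, div_le_iff₀ hA0, sum_comm]
  calc _ ≤ ∑ u ∈ A, C := by
        refine sum_le_sum fun u _ => ?_
        refine le_trans (le_of_eq ?_) (hC (u + z))
        refine sum_congr rfl fun t _ => ?_
        congr 1; abel
    _ = _ := by simp; ring

end AlmostPeriodicity

section Fourier

variable {G : Type*} [AddCommGroup G] [Fintype G] [DecidableEq G]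

/-- The average of a character over a finite set. -/
noncomputable def charAvg (T : Finset G) (γ : AddChar G ℂ) : ℂ := (∑ u ∈ T, γ u) / #T

lemma norm_charAvg_le_one (T : Finset G) (γ : AddChar G ℂ) : ‖charAvg T γ‖ ≤ 1 := by
  unfold charAvg
  rw [norm_div, Complex.norm_natCast]
  refine div_le_one_of_le₀ ((norm_sum_le _ _).trans ?_) (by positivity)
  simp

lemma avgDiff_char (T : Finset G) (h : G → ℝ) (c : AddChar G ℂ → ℂ)
    (hc : ∀ t, (h t : ℂ) = ∑ γ, c γ * γ (-t)) (t : G) :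
    (avgDiff T h t : ℂ) = ∑ γ, c γ * (‖charAvg T γ‖ ^ 2 : ℝ) * γ (-t) := by
  unfold avgDiff
  push_cast
  simp_rw [hc]
  have h1 : ∑ u ∈ T, ∑ u' ∈ T, ∑ γ : AddChar G ℂ, c γ * γ (-(t + u - u')) =
      ∑ γ : AddChar G ℂ, ∑ u ∈ T, ∑ u' ∈ T, c γ * γ (-(t + u - u')) := by
    symm
    rw [sum_comm]
    refine sum_congr rfl fun u _ => ?_
    rw [sum_comm]
  rw [h1, sum_div]
  refine sum_congr rfl fun γ _ => ?_
  have h2 : ((‖charAvg T γ‖ : ℂ)) ^ 2 = charAvg T γ * (starRingEnd ℂ) (charAvg T γ) :=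
    (Complex.mul_conj' _).symm
  rw [h2]
  unfold charAvg
  rw [map_div₀, map_sum, Complex.conj_natCast]
  have h3 : ∀ u u', c γ * γ (-(t + u - u')) = c γ * γ (-t) * (γ u' * (starRingEnd ℂ) (γ u)) := by
    intro u u'
    rw [show -(t + u - u') = -t + (u' + -u) by abel, AddChar.map_add_eq_mul,
      AddChar.map_add_eq_mul, AddChar.map_neg_eq_conj γ u]
    ring
  simp_rw [h3, ← mul_sum, ← sum_mul]
  rw [← mul_sum]
  ring

lemma avgDiff_iterate_char (T : Finset G) (h : G → ℝ) (c : AddChar G ℂ → ℂ)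
    (hc : ∀ t, (h t : ℂ) = ∑ γ, c γ * γ (-t)) (r : ℕ) (t : G) :
    ((avgDiff T)^[r] h t : ℂ) = ∑ γ, c γ * ((‖charAvg T γ‖ ^ 2) ^ r : ℝ) * γ (-t) := by
  induction r generalizing t with
  | zero => simpa using hc t
  | succ r ih =>
    rw [Function.iterate_succ_apply', avgDiff_char T _ _ ih]
    refine sum_congr rfl fun γ _ => ?_
    push_cast
    ring

lemma parseval (f : G → ℝ) :
    ∑ γ : AddChar G ℂ, ‖∑ x, (f x : ℂ) * γ x‖ ^ 2 = Fintype.card G * ∑ x, f x ^ 2 := by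
  have h : (∑ γ : AddChar G ℂ, ((‖∑ x, (f x : ℂ) * γ x‖ : ℂ)) ^ 2) =
      Fintype.card G * ∑ x, (f x : ℂ) ^ 2 := by
    have h1 : ∀ γ : AddChar G ℂ, ((‖∑ x, (f x : ℂ) * γ x‖ : ℂ)) ^ 2 =
        ∑ x, ∑ y, (f x : ℂ) * f y * γ (x - y) := by
      intro γ
      rw [← Complex.mul_conj', map_sum, sum_mul_sum]
      refine sum_congr rfl fun x _ => sum_congr rfl fun y _ => ?_
      rw [map_mul, Complex.conj_ofReal, sub_eq_add_neg, AddChar.map_add_eq_mul,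
        AddChar.map_neg_eq_conj]
      ring
    simp_rw [h1]
    rw [sum_comm, mul_sum]
    refine sum_congr rfl fun x _ => ?_
    rw [sum_comm]
    simp_rw [← mul_sum, AddChar.sum_apply_eq_ite, sub_eq_zero]
    simp
    ring
  exact_mod_cast h

lemma smooth_char (A : Finset G) (f : G → ℝ) (t : G) :
    (smooth A f t : ℂ) = ∑ γ : AddChar G ℂ,
      ((∑ x, (f x : ℂ) * γ x) * (∑ x, (ind A x : ℂ) * γ x) / (#A * Fintype.card G)) * γ (-t) := by
  have hG : (Fintype.card G : ℂ) ≠ 0 := by exact_mod_cast Fintype.card_ne_zero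
  have h1 : ∀ γ : AddChar G ℂ,
      ((∑ x, (f x : ℂ) * γ x) * (∑ x, (ind A x : ℂ) * γ x) / (#A * Fintype.card G)) * γ (-t) =
      (∑ x, ∑ y ∈ A, (f x : ℂ) * γ (x - (t - y))) / (#A * Fintype.card G) := by
    intro γ
    rw [div_mul_eq_mul_div]
    congr 1
    have : ∑ x, (ind A x : ℂ) * γ x = ∑ y ∈ A, γ y := by
      simp [ind, apply_ite Complex.ofReal]
    rw [this, sum_mul_sum, sum_mul]
    refine sum_congr rfl fun x _ => ?_
    rw [sum_mul]
    refine sum_congr rfl fun y _ => ?_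
    rw [show x - (t - y) = x + (y + -t) by abel, AddChar.map_add_eq_mul, AddChar.map_add_eq_mul]
    ring
  simp_rw [h1]
  rw [← sum_div, sum_comm]
  have h2 : ∀ x, ∑ γ : AddChar G ℂ, ∑ y ∈ A, (f x : ℂ) * γ (x - (t - y)) =
      ∑ y ∈ A, if x = t - y then (f x : ℂ) * Fintype.card G else 0 := by
    intro x
    rw [sum_comm]
    refine sum_congr rfl fun y _ => ?_
    rw [← mul_sum, AddChar.sum_apply_eq_ite]
    simp_rw [sub_eq_zero]
    split_ifs <;> simp
  simp_rw [h2]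
  rw [sum_comm]
  simp only [sum_ite_eq', mem_univ, if_true]
  unfold smooth
  push_cast
  rw [← sum_mul, mul_div_mul_right _ _ hG]

/-- Fourier bootstrapping: iterated averages over `T - T` are nearly constant along any `t` almost
annihilated by the large spectrum of `T`. -/
lemma bootstrap (A Z T : Finset G) (hA : A.Nonempty) (f : G → ℝ) (hf0 : ∀ x, 0 ≤ f x)
    (hf1 : ∀ x, f x ≤ 1) (hfZ : ∀ x, x ∉ Z → f x = 0) (r : ℕ) (t : G) {ν : ℝ} (hν : 0 ≤ ν)
    (ht : ∀ γ : AddChar G ℂ, 1 / 2 ≤ ‖charAvg T γ‖ → ‖γ t - 1‖ ≤ ν) :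
    |(avgDiff T)^[r] (smooth A f) t - (avgDiff T)^[r] (smooth A f) 0| ≤
      (ν + 2 * (1 / 4) ^ r) * √(#Z / #A) := by
  have hA0 : (0 : ℝ) < #A := by exact_mod_cast hA.card_pos
  have hG0 : (0 : ℝ) < Fintype.card G := by exact_mod_cast Fintype.card_pos
  set a : AddChar G ℂ → ℝ := fun γ => ‖∑ x, (f x : ℂ) * γ x‖ with ha
  set b : AddChar G ℂ → ℝ := fun γ => ‖∑ x, (ind A x : ℂ) * γ x‖ with hb
  have hf2 : ∑ x, f x ^ 2 ≤ #Z := by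
    calc ∑ x, f x ^ 2 ≤ ∑ x, ind Z x := by
          refine sum_le_sum fun x _ => ?_
          unfold ind
          split_ifs with h
          · exact pow_le_one₀ (hf0 x) (hf1 x)
          · simp [hfZ x h]
      _ = _ := sum_ind Z
  have hA2 : ∑ x, ind A x ^ 2 = #A := by simp [ind]
  have hsum : ∑ γ, a γ * b γ ≤ #A * Fintype.card G * √(#Z / #A) := by
    refine le_of_sq_le_sq ?_ (by positivity)
    calc (∑ γ, a γ * b γ) ^ 2 ≤ (∑ γ, a γ ^ 2) * ∑ γ, b γ ^ 2 := sum_mul_sq_le_sq_mul_sq _ _ _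
      _ = (Fintype.card G * ∑ x, f x ^ 2) * (Fintype.card G * #A) := by
          rw [ha, hb, parseval, parseval, hA2]
      _ ≤ (Fintype.card G * #Z) * (Fintype.card G * #A) := by gcongr
      _ = _ := by
          rw [mul_pow, Real.sq_sqrt (by positivity)]
          field_simp
  have key : ∀ γ : AddChar G ℂ, (‖charAvg T γ‖ ^ 2) ^ r * ‖γ (-t) - 1‖ ≤ ν + 2 * (1 / 4) ^ r := by
    intro γ
    have h1 : ‖γ (-t) - 1‖ = ‖γ t - 1‖ := by
      rw [AddChar.map_neg_eq_conj, ← RCLike.norm_conj (γ t - 1)]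
      simp
    rw [h1]
    have h2 := norm_charAvg_le_one T γ
    rcases le_or_gt (1 / 2) ‖charAvg T γ‖ with h | h
    · have h3 : (‖charAvg T γ‖ ^ 2) ^ r ≤ 1 := pow_le_one₀ (by positivity)
        (pow_le_one₀ (norm_nonneg _) h2)
      have h4 := ht γ h
      have h5 : (0 : ℝ) ≤ 2 * (1 / 4) ^ r := by positivity
      have := mul_le_mul h3 h4 (norm_nonneg _) zero_le_one
      linarith
    · have h3 : (‖charAvg T γ‖ ^ 2) ^ r ≤ (1 / 4) ^ r := by
        refine pow_le_pow_left₀ (by positivity) ?_ r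
        nlinarith [norm_nonneg (charAvg T γ)]
      have h4 : ‖γ t - 1‖ ≤ 2 := by
        calc _ ≤ ‖γ t‖ + ‖(1 : ℂ)‖ := norm_sub_le _ _
          _ = 2 := by simp; norm_num
      have := mul_le_mul h3 h4 (norm_nonneg _) (by positivity)
      linarith
  have hF := avgDiff_iterate_char T (smooth A f) _ (smooth_char A f) r
  have hsub : (((avgDiff T)^[r] (smooth A f) t - (avgDiff T)^[r] (smooth A f) 0 : ℝ) : ℂ) =
      ∑ γ : AddChar G ℂ, ((∑ x, (f x : ℂ) * γ x) * (∑ x, (ind A x : ℂ) * γ x) /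
        (#A * Fintype.card G)) * ((‖charAvg T γ‖ ^ 2) ^ r : ℝ) * (γ (-t) - 1) := by
    rw [Complex.ofReal_sub, hF, hF, ← sum_sub_distrib]
    refine sum_congr rfl fun γ _ => ?_
    simp only [neg_zero, AddChar.map_zero_eq_one]
    ring
  rw [← Real.norm_eq_abs, ← Complex.norm_real, hsub]
  calc _ ≤ ∑ γ : AddChar G ℂ, a γ * b γ / (#A * Fintype.card G) * (ν + 2 * (1 / 4) ^ r) := by
        refine (norm_sum_le _ _).trans (sum_le_sum fun γ _ => ?_)
        rw [mul_assoc, norm_mul]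
        have h1 : ‖(∑ x, (f x : ℂ) * γ x) * (∑ x, (ind A x : ℂ) * γ x) /
            ((#A : ℂ) * Fintype.card G)‖ = a γ * b γ / (#A * Fintype.card G) := by
          rw [norm_div, norm_mul, norm_mul, Complex.norm_natCast, Complex.norm_natCast]
        rw [h1]
        refine mul_le_mul_of_nonneg_left ?_ (by positivity)
        rw [norm_mul, Complex.norm_real, Real.norm_of_nonneg (by positivity)]
        exact key γ
    _ = (∑ γ, a γ * b γ) / (#A * Fintype.card G) * (ν + 2 * (1 / 4) ^ r) := by
        rw [sum_div, sum_mul]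
    _ ≤ √(#Z / #A) * (ν + 2 * (1 / 4) ^ r) := by
        refine mul_le_mul_of_nonneg_right ?_ (by positivity)
        rw [div_le_iff₀ (by positivity)]
        linarith
    _ = _ := mul_comm _ _

end Fourier

section Chang

variable {G : Type*} [AddCommGroup G] [Fintype G] [DecidableEq G]

lemma norm_sum_shift_sub_le {E : Type*} [NormedAddCommGroup E] (V V' : Finset G) (f : G → E) {M : ℝ}
    (hf : ∀ x, ‖f x‖ ≤ M) {κ : ℝ} (hM : 0 ≤ M) (hV : V ⊆ V') (t : G) (ht : ∀ x ∈ V, x + t ∈ V')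
    (hcard : (#V' : ℝ) ≤ (1 + κ) * #V) :
    ‖∑ x ∈ V, f (x + t) - ∑ x ∈ V, f x‖ ≤ 2 * κ * #V * M := by
  have key : ∀ W ⊆ V', #W = #V → ‖∑ x ∈ V', f x - ∑ x ∈ W, f x‖ ≤ κ * #V * M := by
    intro W hW hc
    rw [← sum_sdiff hW, add_sub_cancel_right]
    calc _ ≤ ∑ x ∈ V' \ W, M := norm_sum_le_of_le _ fun x _ => hf x
      _ = #(V' \ W) * M := by simp
      _ ≤ _ := by
        rw [cast_card_sdiff hW, hc]
        refine mul_le_mul_of_nonneg_right ?_ hM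
        linarith
  have h1 := key V hV rfl
  have h2 := key (V.map (Equiv.addRight t).toEmbedding) (by
    intro y hy
    obtain ⟨x, hx, rfl⟩ := mem_map.1 hy
    exact ht x hx) (card_map _)
  rw [sum_map] at h2
  simp only [Equiv.coe_toEmbedding, Equiv.coe_addRight] at h2
  calc _ = ‖(∑ x ∈ V', f x - ∑ x ∈ V, f x) - (∑ x ∈ V', f x - ∑ x ∈ V, f (x + t))‖ := by
        congr 1; abel
    _ ≤ _ := (norm_sub_le _ _).trans (by linarith)

lemma norm_charAvg_mul_le (V V' : Finset G) (hVne : V.Nonempty) (χ : AddChar G ℂ) {κ : ℝ}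
    (hV : V ⊆ V') (t : G) (ht : ∀ x ∈ V, x + t ∈ V') (hcard : (#V' : ℝ) ≤ (1 + κ) * #V) :
    ‖charAvg V χ‖ * ‖χ t - 1‖ ≤ 2 * κ := by
  have hV0 : (0 : ℝ) < #V := by exact_mod_cast hVne.card_pos
  have h := norm_sum_shift_sub_le V V' (fun x => χ x) (M := 1) (fun x => (AddChar.norm_apply χ x).le)
    zero_le_one hV t ht hcard
  simp_rw [AddChar.map_add_eq_mul] at h
  rw [← sum_mul, ← mul_sub_one, norm_mul] at h
  unfold charAvg
  rw [norm_div, Complex.norm_natCast, div_mul_eq_mul_div, div_le_iff₀ hV0]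
  linarith

lemma charAvg_inv (V : Finset G) (χ : AddChar G ℂ) : ‖charAvg V χ⁻¹‖ = ‖charAvg V χ‖ := by
  unfold charAvg
  rw [norm_div, norm_div]
  congr 1
  rw [← RCLike.norm_conj (∑ u ∈ V, χ u), map_sum]
  simp_rw [← AddChar.map_neg_eq_conj]
  rfl

lemma addChar_prod_apply {ι : Type*} (s : Finset ι) (f : ι → AddChar G ℂ) (x : G) :
    (∏ i ∈ s, f i) x = ∏ i ∈ s, f i x := by
  classical
  induction s using Finset.induction_on with
  | empty => simp
  | insert a s ha ih => rw [prod_insert ha, prod_insert ha, AddChar.mul_apply, ih]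

lemma norm_mul_sub_one_le {a b : ℂ} (ha : ‖a‖ = 1) : ‖a * b - 1‖ ≤ ‖a - 1‖ + ‖b - 1‖ := by
  calc ‖a * b - 1‖ = ‖a * (b - 1) + (a - 1)‖ := by congr 1; ring
    _ ≤ ‖a * (b - 1)‖ + ‖a - 1‖ := norm_add_le _ _
    _ = _ := by rw [norm_mul, ha]; ring

lemma norm_prod_sub_one_le {ι : Type*} (s : Finset ι) (f : ι → ℂ) (hf : ∀ i ∈ s, ‖f i‖ = 1) :
    ‖∏ i ∈ s, f i - 1‖ ≤ ∑ i ∈ s, ‖f i - 1‖ := by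
  classical
  induction s using Finset.induction_on with
  | empty => simp
  | insert a s ha ih =>
    rw [prod_insert ha, sum_insert ha]
    have := ih fun i hi => hf i (mem_insert_of_mem hi)
    have := norm_mul_sub_one_le (b := ∏ i ∈ s, f i) (hf a (mem_insert_self _ _))
    linarith

/-- A signed exponent vector. -/
def IsSign (j : ℤ) : Prop := j = -1 ∨ j = 0 ∨ j = 1

lemma norm_zpow_sub_one_le (γ : AddChar G ℂ) {j : ℤ} (hj : IsSign j) (t : G) :
    ‖(γ ^ j) t - 1‖ ≤ ‖γ t - 1‖ := by
  rcases hj with rfl | rfl | rfl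
  · rw [zpow_neg_one, AddChar.inv_apply, AddChar.map_neg_eq_conj, ← RCLike.norm_conj (γ t - 1)]
    simp
  · simp
  · simp

/-- Chang's inequality relative to `U₂`, via a Riesz product. -/
lemma riesz_product (T U' U₂ : Finset G) (hT : T.Nonempty) (hU₂ : U₂.Nonempty)
    (hadd : ∀ t ∈ T, ∀ u ∈ U₂, t + u ∈ U') {τ ξ : ℝ} (hτ : τ * #U' ≤ #T)
    {ι : Type*} [Fintype ι] [DecidableEq ι] (lam : ι → AddChar G ℂ)
    (hlam : ∀ i, 1 / 2 ≤ ‖charAvg T (lam i)‖) (hξ0 : 0 ≤ ξ)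
    (hξ : ξ * Real.exp (Fintype.card ι / 2) ≤ 1)
    (hdiss : ∀ ε : ι → ℤ, (∀ i, IsSign (ε i)) → ε ≠ 0 → ‖charAvg U₂ (∏ i, lam i ^ ε i)‖ ≤ ξ) :
    τ * Real.exp (Fintype.card ι / 8) ≤ 2 := by
  have hT0 : (0 : ℝ) < #T := by exact_mod_cast hT.card_pos
  have hU0 : (0 : ℝ) < #U₂ := by exact_mod_cast hU₂.card_pos
  have hU'0 : (0 : ℝ) < #U' := by
    obtain ⟨t, ht⟩ := hT
    obtain ⟨u, hu⟩ := hU₂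
    exact_mod_cast card_pos.2 ⟨_, hadd t ht u hu⟩
  set m : ℕ := Fintype.card ι with hm
  have hc : ∀ i, ∃ c : ℂ, ‖c‖ = 1 ∧ c * ∑ x ∈ T, lam i x = ‖∑ x ∈ T, lam i x‖ := by
    intro i
    set z := ∑ x ∈ T, lam i x
    rcases eq_or_ne z 0 with h | h
    · exact ⟨1, by simp, by simp [h]⟩
    · have hz : (‖z‖ : ℂ) ≠ 0 := by exact_mod_cast norm_ne_zero_iff.2 h
      refine ⟨(starRingEnd ℂ) z / ‖z‖, ?_, ?_⟩
      · rw [norm_div, RCLike.norm_conj, Complex.norm_real, norm_norm,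
          div_self (norm_ne_zero_iff.2 h)]
      · rw [div_mul_eq_mul_div, mul_comm, Complex.mul_conj']
        field_simp
  choose c hc1 hc2 using hc
  let u : ι → G → ℝ := fun i x => (c i * lam i x).re
  have hu1 : ∀ i x, |u i x| ≤ 1 := by
    intro i x
    refine (Complex.abs_re_le_norm _).trans ?_
    rw [norm_mul, hc1, AddChar.norm_apply, one_mul]
  have huT : ∀ i, #T / 2 ≤ ∑ x ∈ T, u i x := by
    intro i
    have h1 : ∑ x ∈ T, u i x = ‖∑ x ∈ T, lam i x‖ := by
      have := congrArg Complex.re (hc2 i)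
      rw [mul_sum, Complex.re_sum, Complex.ofReal_re] at this
      exact this
    have h2 := hlam i
    unfold charAvg at h2
    rw [norm_div, Complex.norm_natCast, le_div_iff₀ hT0] at h2
    linarith
  let R : G → ℝ := fun x => ∏ i, (Real.cosh (1 / 2) + u i x * Real.sinh (1 / 2))
  have hexpR : ∀ x, Real.exp (∑ i, u i x * (1 / 2)) ≤ R x := by
    intro x
    rw [Real.exp_sum]
    exact prod_le_prod (fun _ _ => (Real.exp_pos _).le) fun i _ =>
      Real.exp_mul_le_cosh_add_mul_sinh (hu1 i x) _
  have hR0 : ∀ x, 0 ≤ R x := fun x => (Real.exp_pos _).le.trans (hexpR x)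
  have hlow : #T * Real.exp (m / 4) ≤ ∑ x ∈ T, R x := by
    have h1 : ∀ x, Real.exp (m / 4) * (1 + (∑ i, u i x * (1 / 2) - m / 4)) ≤ R x := by
      intro x
      refine le_trans ?_ (hexpR x)
      rw [show ∑ i, u i x * (1 / 2) = m / 4 + (∑ i, u i x * (1 / 2) - m / 4) by ring, Real.exp_add]
      refine mul_le_mul_of_nonneg_left ?_ (Real.exp_pos _).le
      have := Real.add_one_le_exp (∑ i, u i x * (1 / 2) - m / 4)
      ring_nf at this ⊢
      linarith
    refine le_trans ?_ (sum_le_sum fun x _ => h1 x)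
    rw [← mul_sum, mul_comm]
    refine mul_le_mul_of_nonneg_left ?_ (Real.exp_pos _).le
    rw [sum_add_distrib, sum_sub_distrib, sum_comm]
    have h2 : ∑ i : ι, (#T / 2 : ℝ) * (1 / 2) ≤ ∑ i, ∑ x ∈ T, u i x * (1 / 2) := by
      refine sum_le_sum fun i _ => ?_
      rw [← sum_mul]
      have := huT i
      linarith
    simp only [sum_const, card_univ, nsmul_eq_mul, ← hm] at h2 ⊢
    linarith
  have hshift : #U₂ * ∑ x ∈ T, R x ≤ ∑ y ∈ U₂, ∑ x ∈ U', R (x - y) := by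
    rw [← nsmul_eq_mul, ← sum_const]
    refine sum_le_sum fun y hy => ?_
    calc ∑ x ∈ T, R x = ∑ x ∈ T.map (Equiv.addRight y).toEmbedding, R (x - y) := by
          rw [sum_map]; simp
      _ ≤ _ := by
          refine sum_le_sum_of_subset_of_nonneg ?_ fun x _ _ => hR0 _
          intro z hz
          obtain ⟨x, hx, rfl⟩ := mem_map.1 hz
          exact hadd x hx y hy
  let w : ι → ℤ → ℂ := fun i j =>
    if j = 0 then Real.cosh (1 / 2) else if j = 1 then c i * Real.sinh (1 / 2) / 2 else
      (starRingEnd ℂ) (c i) * Real.sinh (1 / 2) / 2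
  let J : Finset ℤ := {-1, 0, 1}
  have hJ : ∀ {α : Type} [AddCommMonoid α] (f : ℤ → α), ∑ j ∈ J, f j = f (-1) + (f 0 + f 1) := by
    intro α _ f
    rw [sum_insert (by decide), sum_insert (by decide), sum_singleton]
  let Q : Finset (ι → ℤ) := Fintype.piFinset fun _ => J
  have hexpand : ∀ x, (R x : ℂ) = ∑ ε ∈ Q, (∏ i, w i (ε i)) * (∏ i, lam i ^ ε i) x := by
    intro x
    have h1 : ∀ i, ((Real.cosh (1 / 2) + u i x * Real.sinh (1 / 2) : ℝ) : ℂ) =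
        ∑ j ∈ J, w i j * (lam i ^ j) x := by
      intro i
      rw [hJ]
      have h2 : ((u i x : ℝ) : ℂ) =
          (c i * lam i x + (starRingEnd ℂ) (c i) * (starRingEnd ℂ) (lam i x)) / 2 := by
        rw [Complex.re_eq_add_conj, map_mul]
      simp only [w]
      push_cast
      rw [h2, zpow_neg_one, AddChar.inv_apply, AddChar.map_neg_eq_conj]
      norm_num
      ring
    simp only [R]
    rw [Complex.ofReal_prod]
    simp_rw [h1]
    rw [prod_univ_sum]
    refine sum_congr rfl fun ε _ => ?_
    rw [prod_mul_distrib, addChar_prod_apply]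
  have hchar : ∀ χ : AddChar G ℂ, ‖∑ y ∈ U₂, ∑ x ∈ U', χ (x - y)‖ ≤ #U' * #U₂ * ‖charAvg U₂ χ‖ := by
    intro χ
    have h1 : ∑ y ∈ U₂, ∑ x ∈ U', χ (x - y) = (∑ x ∈ U', χ x) * ∑ y ∈ U₂, χ⁻¹ y := by
      rw [mul_comm, sum_mul_sum]
      refine sum_congr rfl fun y _ => sum_congr rfl fun x _ => ?_
      rw [sub_eq_add_neg, AddChar.map_add_eq_mul, AddChar.inv_apply, mul_comm]
    have h2 : ‖∑ y ∈ U₂, χ⁻¹ y‖ = #U₂ * ‖charAvg U₂ χ‖ := by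
      rw [← charAvg_inv, charAvg, norm_div, Complex.norm_natCast, mul_div_cancel₀ _ hU0.ne']
    rw [h1, norm_mul, h2, mul_assoc]
    refine mul_le_mul_of_nonneg_right ?_ (by positivity)
    refine (norm_sum_le _ _).trans ?_
    simp
  have hc0 : 0 < Real.cosh (1 / 2) := Real.cosh_pos _
  have hs0 : 0 < Real.sinh (1 / 2) := Real.sinh_pos_iff.2 (by norm_num)
  have hsumw : ∑ ε ∈ Q, ∏ i, ‖w i (ε i)‖ = Real.exp (m / 2) := by
    rw [← prod_univ_sum (fun _ => J) fun i j => ‖w i j‖]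
    have h1 : ∀ i, ∑ j ∈ J, ‖w i j‖ = Real.exp (1 / 2) := by
      intro i
      rw [hJ]
      simp only [w]
      norm_num
      rw [hc1]
      have h3 : ‖Complex.cosh (1 / 2)‖ = Real.cosh (1 / 2) := by
        rw [show (1 / 2 : ℂ) = ((1 / 2 : ℝ) : ℂ) by norm_num, ← Complex.ofReal_cosh,
          Complex.norm_real, Real.norm_of_nonneg hc0.le]
      have h4 : ‖Complex.sinh (1 / 2)‖ = Real.sinh (1 / 2) := by
        rw [show (1 / 2 : ℂ) = ((1 / 2 : ℝ) : ℂ) by norm_num, ← Complex.ofReal_sinh,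
          Complex.norm_real, Real.norm_of_nonneg hs0.le]
      rw [h3, h4, ← Real.cosh_add_sinh]
      ring
    simp_rw [h1]
    rw [prod_const, card_univ, ← hm, ← Real.exp_nat_mul]
    congr 1; ring
  have hQ0 : (0 : ι → ℤ) ∈ Q := by simp [Q, J]
  have hup : ∑ y ∈ U₂, ∑ x ∈ U', R (x - y) ≤
      #U' * #U₂ * (Real.cosh (1 / 2) ^ m + ξ * Real.exp (m / 2)) := by
    have h1 : ((∑ y ∈ U₂, ∑ x ∈ U', R (x - y) : ℝ) : ℂ) =
        ∑ ε ∈ Q, (∏ i, w i (ε i)) * ∑ y ∈ U₂, ∑ x ∈ U', (∏ i, lam i ^ ε i) (x - y) := by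
      simp_rw [Complex.ofReal_sum, hexpand, mul_sum]
      symm
      rw [sum_comm]
      refine sum_congr rfl fun y _ => ?_
      rw [sum_comm]
    have h2 : ∑ y ∈ U₂, ∑ x ∈ U', R (x - y) = ‖((∑ y ∈ U₂, ∑ x ∈ U', R (x - y) : ℝ) : ℂ)‖ := by
      rw [Complex.norm_real, Real.norm_of_nonneg]
      exact sum_nonneg fun _ _ => sum_nonneg fun _ _ => hR0 _
    rw [h2, h1]
    refine (norm_sum_le _ _).trans ?_
    rw [← add_sum_erase _ _ hQ0, mul_add]
    refine add_le_add ?_ ?_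
    · rw [norm_mul]
      have h3 : ‖∏ i, w i ((0 : ι → ℤ) i)‖ = Real.cosh (1 / 2) ^ m := by
        simp only [w, Pi.zero_apply, if_true]
        rw [prod_const, card_univ, norm_pow, Complex.norm_real, Real.norm_of_nonneg hc0.le]
      rw [h3, mul_comm]
      refine mul_le_mul_of_nonneg_right ?_ (by positivity)
      refine (hchar _).trans ?_
      have := norm_charAvg_le_one U₂ (∏ i, lam i ^ ((0 : ι → ℤ) i))
      have h5 : (0 : ℝ) ≤ #U' * #U₂ := by positivity
      nlinarith
    · calc _ ≤ ∑ ε ∈ Q.erase 0, (∏ i, ‖w i (ε i)‖) * (#U' * #U₂ * ξ) := by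
            refine sum_le_sum fun ε hε => ?_
            rw [norm_mul, norm_prod]
            refine mul_le_mul_of_nonneg_left ?_ (prod_nonneg fun i _ => norm_nonneg _)
            refine (hchar _).trans ?_
            refine mul_le_mul_of_nonneg_left ?_ (by positivity)
            refine hdiss ε ?_ (ne_of_mem_erase hε)
            intro i
            have := Fintype.mem_piFinset.1 (mem_of_mem_erase hε) i
            simpa [J, IsSign] using this
        _ ≤ ∑ ε ∈ Q, (∏ i, ‖w i (ε i)‖) * (#U' * #U₂ * ξ) := by
            refine sum_le_sum_of_subset_of_nonneg (erase_subset _ _) fun ε _ _ => ?_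
            have : 0 ≤ ∏ i, ‖w i (ε i)‖ := prod_nonneg fun i _ => norm_nonneg _
            positivity
        _ = _ := by rw [← sum_mul, hsumw]; ring
  have hcosh : Real.cosh (1 / 2) ^ m ≤ Real.exp (m / 8) := by
    calc _ ≤ Real.exp ((1 / 2) ^ 2 / 2) ^ m :=
          pow_le_pow_left₀ hc0.le (Real.cosh_le_exp_half_sq _) _
      _ = _ := by rw [← Real.exp_nat_mul]; congr 1; ring
  have hone : 1 ≤ Real.exp ((m : ℝ) / 8) := Real.one_le_exp (by positivity)
  have hexp : Real.exp ((m : ℝ) / 4) = Real.exp (m / 8) * Real.exp (m / 8) := by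
    rw [← Real.exp_add]; congr 1; ring
  have hfin : #U₂ * (#T * Real.exp (m / 4)) ≤ #U' * #U₂ * (2 * Real.exp (m / 8)) := by
    calc _ ≤ #U₂ * ∑ x ∈ T, R x := by gcongr
      _ ≤ _ := hshift.trans hup
      _ ≤ _ := by
        refine mul_le_mul_of_nonneg_left ?_ (by positivity)
        linarith
  have h6 : #U₂ * (#U' * Real.exp (m / 8)) * (τ * Real.exp (m / 8)) ≤
      #U₂ * (#U' * Real.exp (m / 8)) * 2 := by
    have h7 : #U₂ * (τ * #U' * Real.exp (m / 4)) ≤ #U₂ * (#T * Real.exp (m / 4)) := by gcongr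
    rw [hexp] at h7 hfin
    linarith
  exact le_of_mul_le_mul_left h6 (by positivity)

lemma exists_spectrum_structure (T U' U₂ : Finset G) (hT : T.Nonempty) (hU₂ : U₂.Nonempty)
    (hadd : ∀ t ∈ T, ∀ u ∈ U₂, t + u ∈ U') {τ ξ : ℝ} (hτ : τ * #U' ≤ #T) (P : ℕ)
    (hP : 2 < τ * Real.exp ((P + 1) / 8)) (hξ0 : 0 ≤ ξ) (hξ1 : ξ < 1)
    (hξ : ξ * Real.exp ((P + 1) / 2) ≤ 1) :
    ∃ Λ : Finset (AddChar G ℂ), #Λ ≤ P ∧ ∀ γ : AddChar G ℂ, 1 / 2 ≤ ‖charAvg T γ‖ →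
      ∃ ε : AddChar G ℂ → ℤ, (∀ l, IsSign (ε l)) ∧ ∃ χ, ξ ≤ ‖charAvg U₂ χ‖ ∧
        γ = χ * ∏ l ∈ Λ, l ^ ε l := by
  classical
  let diss : Finset (AddChar G ℂ) → Prop := fun Λ => ∀ ε : AddChar G ℂ → ℤ, (∀ l, IsSign (ε l)) →
    (∃ l ∈ Λ, ε l ≠ 0) → ‖charAvg U₂ (∏ l ∈ Λ, l ^ ε l)‖ ≤ ξ
  have hbound : ∀ Λ, diss Λ → (∀ l ∈ Λ, 1 / 2 ≤ ‖charAvg T l‖) → #Λ ≤ P + 1 → #Λ ≤ P := by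
    intro Λ hd hs hc
    have hc' : (Fintype.card Λ : ℝ) ≤ P + 1 := by rw [Fintype.card_coe]; exact_mod_cast hc
    have h := riesz_product T U' U₂ hT hU₂ hadd hτ (fun l : Λ => (l : AddChar G ℂ))
      (fun l => hs l l.2) hξ0 (le_trans (by gcongr) hξ) (by
        intro ε hε hne
        let ε' : AddChar G ℂ → ℤ := fun l => if h : l ∈ Λ then ε ⟨l, h⟩ else 0
        have h1 := hd ε' (by
          intro l
          simp only [ε']
          split_ifs with h
          · exact hε _
          · exact Or.inr (Or.inl rfl)) (by
          obtain ⟨l, hl⟩ := Function.ne_iff.1 hne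
          exact ⟨l, l.2, by simpa [ε'] using hl⟩)
        rw [← prod_coe_sort] at h1
        simpa [ε'] using h1)
    by_contra hcon
    have heq : #Λ = P + 1 := by omega
    rw [Fintype.card_coe, heq] at h
    push_cast at h
    linarith
  let S : Finset (Finset (AddChar G ℂ)) :=
    {Λ | diss Λ ∧ (∀ l ∈ Λ, 1 / 2 ≤ ‖charAvg T l‖) ∧ #Λ ≤ P}
  have hS : S.Nonempty := ⟨∅, by simp [S, diss]⟩
  obtain ⟨Λ, hΛ, hmax⟩ := exists_max_image S card hS
  obtain ⟨hd, hs, hc⟩ := (mem_filter.1 hΛ).2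
  refine ⟨Λ, hc, fun γ hγ => ?_⟩
  by_cases hγΛ : γ ∈ Λ
  · refine ⟨fun l => if l = γ then 1 else 0, ?_, 1, ?_, ?_⟩
    · intro l
      dsimp only
      split_ifs
      · exact Or.inr (Or.inr rfl)
      · exact Or.inr (Or.inl rfl)
    · have : charAvg U₂ (1 : AddChar G ℂ) = 1 := by
        have : (#U₂ : ℂ) ≠ 0 := by exact_mod_cast hU₂.card_pos.ne'
        simp [charAvg, this]
      rw [this]
      simpa using hξ1.le
    · rw [one_mul, prod_eq_single γ]
      · simp
      · intro l _ hl; simp [hl]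
      · intro h; exact absurd hγΛ h
  · have hnd : ¬ diss (insert γ Λ) := by
      intro hcon
      have hs' : ∀ l ∈ insert γ Λ, 1 / 2 ≤ ‖charAvg T l‖ := by
        intro l hl
        rcases mem_insert.1 hl with rfl | hl
        · exact hγ
        · exact hs l hl
      have hcc := card_insert_of_notMem hγΛ
      have h1 := hbound _ hcon hs' (by omega)
      have h2 := hmax (insert γ Λ) (mem_filter.2 ⟨mem_univ _, hcon, hs', h1⟩)
      omega
    simp only [diss] at hnd
    push Not at hnd
    obtain ⟨ε, hε, ⟨l, hl, hl0⟩, hbig⟩ := hnd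
    rw [prod_insert hγΛ] at hbig
    have hγ0 : ε γ ≠ 0 := by
      intro h0
      rw [h0, zpow_zero, one_mul] at hbig
      rcases mem_insert.1 hl with rfl | hl
      · exact hl0 h0
      · exact absurd (hd ε hε ⟨l, hl, hl0⟩) (not_le.2 hbig)
    rcases hε γ with h | h | h
    · refine ⟨ε, hε, (γ ^ ε γ * ∏ l ∈ Λ, l ^ ε l)⁻¹, ?_, ?_⟩
      · rw [charAvg_inv]; exact hbig.le
      · rw [h]; simp
    · exact absurd h hγ0
    · refine ⟨fun l => -ε l, ?_, γ ^ ε γ * ∏ l ∈ Λ, l ^ ε l, hbig.le, ?_⟩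
      · intro l
        rcases hε l with h | h | h <;> dsimp only <;> rw [h]
        · exact Or.inr (Or.inr rfl)
        · exact Or.inr (Or.inl rfl)
        · exact Or.inl rfl
      · rw [h]; simp

/-- The large spectrum of `T` is almost annihilated by the points which are almost annihilated by
few characters and which almost preserve `U₂`. -/
lemma exists_annihilator (T U' U₂ U₂' : Finset G) (hT : T.Nonempty) (hU₂ : U₂.Nonempty)
    (hadd : ∀ t ∈ T, ∀ u ∈ U₂, t + u ∈ U') {τ κ ν : ℝ} (hτ : τ * #U' ≤ #T) (P : ℕ)
    (hP : 2 < τ * Real.exp ((P + 1) / 8)) (hsub : U₂ ⊆ U₂')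
    (hcard : (#U₂' : ℝ) ≤ (1 + κ) * #U₂) (hκ : 4 * κ * Real.exp (P + 1) ≤ ν) :
    ∃ Λ : Finset (AddChar G ℂ), #Λ ≤ P ∧ ∀ t, (∀ u ∈ U₂, u + t ∈ U₂') →
      (∀ l ∈ Λ, P * ‖l t - 1‖ ≤ ν / 2) →
      ∀ γ : AddChar G ℂ, 1 / 2 ≤ ‖charAvg T γ‖ → ‖γ t - 1‖ ≤ ν := by
  have hlt : Real.exp (-(P + 1 : ℝ)) < 1 := Real.exp_lt_one_iff.2 (by linarith [P.cast_nonneg (α := ℝ)])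
  obtain ⟨Λ, hΛ, h⟩ := exists_spectrum_structure T U' U₂ hT hU₂ hadd hτ P hP
    (Real.exp_pos (-(P + 1 : ℝ))).le hlt (by
      rw [← Real.exp_add]
      exact Real.exp_le_one_iff.2 (by linarith [P.cast_nonneg (α := ℝ)]))
  refine ⟨Λ, hΛ, fun t ht hl γ hγ => ?_⟩
  obtain ⟨ε, hε, χ, hχ, rfl⟩ := h γ hγ
  rw [AddChar.mul_apply, addChar_prod_apply]
  have h1 := norm_mul_sub_one_le (b := ∏ l ∈ Λ, (l ^ ε l) t) (AddChar.norm_apply χ t)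
  have h2 := norm_prod_sub_one_le Λ (fun l => (l ^ ε l) t) fun l _ => AddChar.norm_apply _ t
  have h3 : ∑ l ∈ Λ, ‖(l ^ ε l) t - 1‖ ≤ ν / 2 := by
    rcases Λ.eq_empty_or_nonempty with h0 | h0
    · rw [h0, sum_empty]
      have h5 := norm_charAvg_mul_le U₂ U₂' hU₂ χ hsub t ht hcard
      have h6 : 0 ≤ κ := by
        have := (mul_nonneg (norm_nonneg (charAvg U₂ χ)) (norm_nonneg (χ t - 1))).trans h5
        linarith
      have : 0 ≤ 4 * κ * Real.exp (P + 1) := by positivity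
      linarith
    have hΛ0 : (0 : ℝ) < #Λ := by exact_mod_cast h0.card_pos
    have hP0 : (#Λ : ℝ) ≤ P := by exact_mod_cast hΛ
    calc _ ≤ ∑ l ∈ Λ, ν / 2 / P := by
          refine sum_le_sum fun l hlΛ => (norm_zpow_sub_one_le l (hε l) t).trans ?_
          rw [le_div_iff₀ (by linarith), mul_comm]
          exact hl l hlΛ
      _ = #Λ * (ν / 2 / P) := by simp
      _ ≤ P * (ν / 2 / P) := by
          refine mul_le_mul_of_nonneg_right hP0 ?_
          obtain ⟨l, hlΛ⟩ := h0
          have := hl l hlΛ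
          have : 0 ≤ (P : ℝ) * ‖l t - 1‖ := by positivity
          have : 0 ≤ ν / 2 := by linarith
          positivity
      _ = _ := mul_div_cancel₀ _ (by linarith)
  have h4 : ‖χ t - 1‖ ≤ ν / 2 := by
    have h5 := norm_charAvg_mul_le U₂ U₂' hU₂ χ hsub t ht hcard
    have h6 : Real.exp (-(P + 1 : ℝ)) * ‖χ t - 1‖ ≤ 2 * κ :=
      (mul_le_mul_of_nonneg_right hχ (norm_nonneg _)).trans h5
    have h7 : Real.exp (P + 1 : ℝ) * Real.exp (-(P + 1 : ℝ)) = 1 := by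
      rw [← Real.exp_add]; simp
    calc ‖χ t - 1‖ = Real.exp (P + 1 : ℝ) * (Real.exp (-(P + 1 : ℝ)) * ‖χ t - 1‖) := by
          rw [← mul_assoc, h7, one_mul]
      _ ≤ Real.exp (P + 1 : ℝ) * (2 * κ) := by gcongr
      _ ≤ _ := by linarith
  linarith

end Chang

section Bohr

variable {G : Type*} [AddCommGroup G] [Fintype G] [DecidableEq G]

open Classical in
/-- The Bohr set with frequency set `Γ` and radius `ρ`. -/
noncomputable def bohr (Γ : Finset (AddChar G ℂ)) (ρ : ℝ) : Finset G :=
  {x | ∀ γ ∈ Γ, ‖γ x - 1‖ ≤ ρ}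

variable {Γ : Finset (AddChar G ℂ)} {ρ σ : ℝ} {x y : G}

lemma mem_bohr : x ∈ bohr Γ ρ ↔ ∀ γ ∈ Γ, ‖γ x - 1‖ ≤ ρ := by simp [bohr]

lemma zero_mem_bohr (hρ : 0 ≤ ρ) : (0 : G) ∈ bohr Γ ρ := by
  rw [mem_bohr]; intro γ _; simpa using hρ

lemma norm_char_neg_sub_one (γ : AddChar G ℂ) (x : G) : ‖γ (-x) - 1‖ = ‖γ x - 1‖ := by
  rw [AddChar.map_neg_eq_conj, ← RCLike.norm_conj (γ x - 1)]
  simp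

lemma neg_mem_bohr (hx : x ∈ bohr Γ ρ) : -x ∈ bohr Γ ρ := by
  rw [mem_bohr] at *
  intro γ hγ
  rw [norm_char_neg_sub_one]
  exact hx γ hγ

lemma add_mem_bohr (hx : x ∈ bohr Γ ρ) (hy : y ∈ bohr Γ σ) : x + y ∈ bohr Γ (ρ + σ) := by
  rw [mem_bohr] at *
  intro γ hγ
  rw [AddChar.map_add_eq_mul]
  exact (norm_mul_sub_one_le (AddChar.norm_apply γ x)).trans (add_le_add (hx γ hγ) (hy γ hγ))

lemma sub_mem_bohr (hx : x ∈ bohr Γ ρ) (hy : y ∈ bohr Γ σ) : x - y ∈ bohr Γ (ρ + σ) := by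
  rw [sub_eq_add_neg]; exact add_mem_bohr hx (neg_mem_bohr hy)

lemma bohr_mono (h : ρ ≤ σ) : bohr Γ ρ ⊆ bohr Γ σ := by
  intro x hx
  rw [mem_bohr] at *
  exact fun γ hγ => (hx γ hγ).trans h

lemma bohr_anti {Γ' : Finset (AddChar G ℂ)} (h : Γ ⊆ Γ') : bohr Γ' ρ ⊆ bohr Γ ρ := by
  intro x hx
  rw [mem_bohr] at *
  exact fun γ hγ => hx γ (h hγ)

lemma bohr_two : bohr Γ 2 = univ := by
  ext x
  simp only [mem_bohr, mem_univ, iff_true]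
  intro γ _
  calc _ ≤ ‖γ x‖ + ‖(1 : ℂ)‖ := norm_sub_le _ _
    _ = 2 := by simp; norm_num

lemma bohr_nonempty (hρ : 0 ≤ ρ) : (bohr Γ ρ).Nonempty := ⟨0, zero_mem_bohr hρ⟩

lemma card_bohr_two_mul_le (Γ : Finset (AddChar G ℂ)) (hρ : 0 < ρ) :
    #(bohr Γ (2 * ρ)) ≤ 81 ^ #Γ * #(bohr Γ ρ) := by
  classical
  let cell : G → Γ → ℤ × ℤ := fun x γ =>
    (⌊((γ : AddChar G ℂ) x - 1).re / (ρ / 2)⌋, ⌊((γ : AddChar G ℂ) x - 1).im / (ρ / 2)⌋)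
  let Q : Finset (Γ → ℤ × ℤ) := Fintype.piFinset fun _ => Icc (-4) 4 ×ˢ Icc (-4) 4
  have hQ : #Q = 81 ^ #Γ := by
    simp [Q]
  have hρ2 : 0 < ρ / 2 := by positivity
  have hfloor : ∀ a : ℝ, |a| ≤ 2 * ρ → ⌊a / (ρ / 2)⌋ ∈ Icc (-4 : ℤ) 4 := by
    intro a ha
    rw [abs_le] at ha
    rw [mem_Icc, Int.le_floor, ← Int.lt_add_one_iff, Int.floor_lt]
    constructor
    · rw [le_div_iff₀ hρ2]; push_cast; linarith
    · rw [div_lt_iff₀ hρ2]; push_cast; linarith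
  have hmaps : ∀ x ∈ bohr Γ (2 * ρ), cell x ∈ Q := by
    intro x hx
    rw [Fintype.mem_piFinset]
    intro γ
    have := mem_bohr.1 hx γ γ.2
    rw [mem_product]
    exact ⟨hfloor _ ((Complex.abs_re_le_norm _).trans this),
      hfloor _ ((Complex.abs_im_le_norm _).trans this)⟩
  rw [← hQ, mul_comm (#Q)]
  refine card_le_mul_card_image_of_maps_to hmaps _ fun c _ => ?_
  rcases ({x ∈ bohr Γ (2 * ρ) | cell x = c} : Finset G).eq_empty_or_nonempty with h | ⟨x₀, hx₀⟩
  · rw [h]; simp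
  refine card_le_card_of_injOn (fun x => x - x₀) ?_ fun a _ b _ h => sub_left_injective h
  intro x hx
  have hc : cell x = cell x₀ := by
    rw [(mem_filter.1 (mem_coe.1 hx)).2, (mem_filter.1 hx₀).2]
  rw [mem_coe, mem_bohr]
  intro γ hγ
  have h1 : ‖γ (x - x₀) - 1‖ = ‖(γ x - 1) - (γ x₀ - 1)‖ := by
    have : γ x = γ (x - x₀) * γ x₀ := by rw [← AddChar.map_add_eq_mul, sub_add_cancel]
    rw [this, show γ (x - x₀) * γ x₀ - 1 - (γ x₀ - 1) = (γ (x - x₀) - 1) * γ x₀ by ring, norm_mul,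
      AddChar.norm_apply, mul_one]
  have h2 := congrFun hc ⟨γ, hγ⟩
  simp only [cell, Prod.mk.injEq] at h2
  have hdiff : ∀ a b : ℝ, ⌊a / (ρ / 2)⌋ = ⌊b / (ρ / 2)⌋ → |a - b| ≤ ρ / 2 := by
    intro a b hab
    have := Int.abs_sub_lt_one_of_floor_eq_floor hab
    rw [← sub_div, abs_div, abs_of_pos hρ2, div_lt_one hρ2] at this
    exact this.le
  rw [h1]
  refine (Complex.norm_le_abs_re_add_abs_im _).trans ?_
  rw [Complex.sub_re (γ x - 1), Complex.sub_im (γ x - 1)]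
  have := hdiff _ _ h2.1
  have := hdiff _ _ h2.2
  linarith

lemma card_le_bohr (Γ : Finset (AddChar G ℂ)) (j : ℕ) :
    Fintype.card G ≤ 81 ^ (#Γ * j) * #(bohr Γ (2 * (1 / 2) ^ j)) := by
  induction j with
  | zero => simp [bohr_two]
  | succ j ih =>
    have h := card_bohr_two_mul_le Γ (ρ := 2 * (1 / 2) ^ (j + 1)) (by positivity)
    have h2 : (2 : ℝ) * (2 * (1 / 2) ^ (j + 1)) = 2 * (1 / 2) ^ j := by rw [pow_succ]; ring
    rw [h2] at h
    calc _ ≤ 81 ^ (#Γ * j) * (81 ^ #Γ * #(bohr Γ (2 * (1 / 2) ^ (j + 1)))) :=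
          ih.trans (Nat.mul_le_mul_left _ h)
      _ = _ := by rw [mul_add, pow_add]; ring

/-- `ρ` is a regular radius: enlarging it by the factor `1 + ω` increases the Bohr set by at most
the factor `1 + κ`. -/
def RegAt (Γ : Finset (AddChar G ℂ)) (ω κ ρ : ℝ) : Prop :=
  (#(bohr Γ ((1 + ω) * ρ)) : ℝ) ≤ (1 + κ) * #(bohr Γ ρ)

lemma exists_regAt (Γ : Finset (AddChar G ℂ)) {D : ℕ} (hD : #Γ ≤ D) {ω κ : ℝ} (hκ0 : 0 < κ)
    (hκ1 : κ ≤ 1) (hω0 : 0 < ω) (hω : ω * (100 * (D + 1)) ≤ κ) (hρ : 0 < ρ) :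
    ∃ ρ', ρ / 2 ≤ ρ' ∧ ρ' ≤ ρ ∧ RegAt Γ ω κ ρ' := by
  set M : ℕ := ⌈10 * D / κ⌉₊ + 1 with hM
  have hM1 : 10 * D / κ < M := by
    rw [hM]; push_cast
    have := Nat.le_ceil (10 * D / κ)
    linarith
  have hM2 : (M : ℝ) ≤ 10 * D / κ + 2 := by
    rw [hM]; push_cast
    have := (Nat.ceil_lt_add_one (show 0 ≤ 10 * D / κ by positivity)).le
    linarith
  have hωM : (1 + ω) ^ M ≤ 2 := by
    have h1 : ω * M ≤ 1 / 2 := by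
      have h2 : ω * (10 * D / κ + 2) ≤ 1 / 2 := by
        have h3 : ω / κ * (100 * (D + 1)) ≤ 1 := by
          rw [div_mul_eq_mul_div, div_le_one hκ0]; exact hω
        have h4 : ω ≤ ω / κ := by
          rw [le_div_iff₀ hκ0]; nlinarith
        have h5 : ω * (10 * D / κ + 2) = ω / κ * (10 * D) + 2 * ω := by ring
        rw [h5]
        nlinarith [div_pos hω0 hκ0, D.cast_nonneg (α := ℝ)]
      nlinarith
    calc (1 + ω) ^ M ≤ Real.exp ω ^ M := by
          refine pow_le_pow_left₀ (by positivity) ?_ _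
          have := Real.add_one_le_exp ω; linarith
      _ = Real.exp (M * ω) := (Real.exp_nat_mul _ _).symm
      _ ≤ Real.exp (1 / 2) := Real.exp_le_exp.2 (by linarith)
      _ ≤ 2 := by
          have h1 : Real.exp (1 / 2) * Real.exp (1 / 2) = Real.exp 1 := by
            rw [← Real.exp_add]; norm_num
          have h2 := Real.exp_one_lt_d9
          have h3 := Real.exp_pos (1 / 2)
          nlinarith
  by_contra hcon
  push Not at hcon
  have hgrow : ∀ i ≤ M, (1 + κ) ^ i * #(bohr Γ (ρ / 2)) ≤ #(bohr Γ ((1 + ω) ^ i * (ρ / 2))) := by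
    intro i
    induction i with
    | zero => simp
    | succ i ih =>
      intro hi
      have h1 := ih (by omega)
      have hone : 1 ≤ (1 + ω) ^ i := one_le_pow₀ (by linarith)
      have htwo : (1 + ω) ^ i ≤ 2 := (pow_le_pow_right₀ (by linarith) (by omega)).trans hωM
      have h2 := hcon ((1 + ω) ^ i * (ρ / 2)) (by nlinarith) (by nlinarith)
      unfold RegAt at h2
      rw [not_le, ← mul_assoc, ← pow_succ'] at h2
      calc _ = (1 + κ) * ((1 + κ) ^ i * #(bohr Γ (ρ / 2))) := by ring
        _ ≤ (1 + κ) * #(bohr Γ ((1 + ω) ^ i * (ρ / 2))) := by gcongr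
        _ ≤ _ := h2.le
  have h1 := hgrow M le_rfl
  have h2 : #(bohr Γ ((1 + ω) ^ M * (ρ / 2))) ≤ 81 ^ #Γ * #(bohr Γ (ρ / 2)) := by
    refine (card_le_card (bohr_mono ?_)).trans (card_bohr_two_mul_le Γ (by positivity))
    gcongr
  have h3 : (#(bohr Γ ((1 + ω) ^ M * (ρ / 2))) : ℝ) ≤ 81 ^ #Γ * #(bohr Γ (ρ / 2)) := by
    exact_mod_cast h2
  have hpos : (0 : ℝ) < #(bohr Γ (ρ / 2)) := by
    exact_mod_cast (bohr_nonempty (by positivity)).card_pos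
  have h4 := le_of_mul_le_mul_right (h1.trans h3) hpos
  have h5 : Real.exp (κ / 2) ≤ 1 + κ := by
    have h6 := Real.one_sub_le_exp_neg (κ / 2)
    have h7 : Real.exp (κ / 2) * Real.exp (-(κ / 2)) = 1 := by rw [← Real.exp_add]; simp
    have h8 := Real.exp_pos (κ / 2)
    by_contra h9
    push Not at h9
    nlinarith [mul_pos hκ0 hκ0]
  have h6 : (81 : ℝ) ^ #Γ < (1 + κ) ^ M := by
    calc (81 : ℝ) ^ #Γ ≤ Real.exp 5 ^ #Γ := by
          refine pow_le_pow_left₀ (by norm_num) ?_ _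
          have h7 : Real.exp 5 = Real.exp 1 ^ 5 := by rw [← Real.exp_nat_mul]; norm_num
          rw [h7]
          calc (81 : ℝ) ≤ 2.7 ^ 5 := by norm_num
            _ ≤ _ := pow_le_pow_left₀ (by norm_num) (by linarith [Real.exp_one_gt_d9]) _
      _ = Real.exp (#Γ * 5) := (Real.exp_nat_mul _ _).symm
      _ < Real.exp (M * (κ / 2)) := by
          refine Real.exp_lt_exp.2 ?_
          rw [div_lt_iff₀ hκ0] at hM1
          have : (#Γ : ℝ) ≤ D := by exact_mod_cast hD
          linarith
      _ = Real.exp (κ / 2) ^ M := Real.exp_nat_mul _ _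
      _ ≤ _ := pow_le_pow_left₀ (Real.exp_pos _).le h5 _
  linarith

open Classical in
/-- The frequencies `γ` read off after halving. -/
noncomputable def halve (e : G ≃+ G) (Γ : Finset (AddChar G ℂ)) : Finset (AddChar G ℂ) :=
  Γ.image fun γ => γ.compAddMonoidHom e.symm.toAddMonoidHom

lemma card_halve_le (e : G ≃+ G) (Γ : Finset (AddChar G ℂ)) : #(halve e Γ) ≤ #Γ := card_image_le

lemma mem_bohr_halve (e : G ≃+ G) : x ∈ bohr (halve e Γ) ρ ↔ e.symm x ∈ bohr Γ ρ := by
  simp [mem_bohr, halve]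

lemma map_mem_bohr_halve (e : G ≃+ G) : e x ∈ bohr (halve e Γ) ρ ↔ x ∈ bohr Γ ρ := by
  rw [mem_bohr_halve]; simp

lemma card_bohr_halve (e : G ≃+ G) : #(bohr (halve e Γ) ρ) = #(bohr Γ ρ) := by
  symm
  refine card_bij (fun x _ => e x) (fun x hx => (map_mem_bohr_halve e).2 hx)
    (fun x _ y _ h => e.injective h) fun y hy => ⟨e.symm y, (mem_bohr_halve e).1 hy, by simp⟩

lemma RegAt.halve {ω κ : ℝ} (h : RegAt Γ ω κ ρ) (e : G ≃+ G) :
    RegAt (halve e Γ) ω κ ρ := by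
  unfold RegAt at *
  rwa [card_bohr_halve, card_bohr_halve]

lemma mem_bohr_of_halve (e : G ≃+ G) (he : ∀ x, e x = x + x) (hx : x ∈ bohr (halve e Γ) ρ) :
    x ∈ bohr Γ (2 * ρ) := by
  have h := (mem_bohr_halve e).1 hx
  have h2 : x = e.symm x + e.symm x := by rw [← he]; simp
  rw [h2, two_mul]
  exact add_mem_bohr h h

end Bohr

section Increment

variable {G : Type*} [AddCommGroup G] [Fintype G] [DecidableEq G]

lemma exists_dense_translate {A W' U : Finset G} (hA : A.Nonempty) (hU : U.Nonempty)
    (S : Finset G)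
    (hS : ∑ x ∈ A, ∑ y ∈ A, (if x - y ∈ S then (0 : ℝ) else 1) ≤ 1 / 1000 * #A ^ 2)
    (V : ℕ → Finset G) (hV0 : 0 ∈ V 0)
    (hV : ∀ i, ∀ t ∈ V i, ∀ u ∈ U, ∀ u' ∈ U, t + u - u' ∈ V (i + 1)) (r k : ℕ) (hk : 0 < k)
    (hAU : ∀ a ∈ A, ∀ u ∈ U, a + u ∈ W') (hVA : ∀ i ≤ r, ∀ t ∈ V i, ∀ y ∈ A, t - y ∈ W')
    {δ β ν : ℝ} (hδ : 0 < δ) (hβ : 4 * Real.exp (-(k * δ ^ 2 / 2)) * #W' ≤ β * #A)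
    (hr : r * (2 * (δ + β)) ≤ 1 / 200) (hν : 0 ≤ ν)
    (hν1 : (ν + 2 * (1 / 4) ^ r) * √(#W' / #A) ≤ 1 / 250) :
    ∃ T ⊆ U, T.Nonempty ∧ (#U : ℝ) * #A ^ k ≤ 2 * #T * #W' ^ k ∧ ∀ B : Finset G,
      (∀ t ∈ B, ∀ γ : AddChar G ℂ, 1 / 2 ≤ ‖charAvg T γ‖ → ‖γ t - 1‖ ≤ ν) →
      ∃ z, 99 / 100 * (#B : ℝ) ≤ #{t ∈ B | z + t ∈ S} := by
  have hA0 : (0 : ℝ) < #A := by exact_mod_cast hA.card_pos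
  have hU0 : (0 : ℝ) < #U := by exact_mod_cast hU.card_pos
  set f : G → ℝ := ind S with hf
  have hf0 := ind_nonneg S
  have hf1 := ind_le_one S
  obtain ⟨T, hTU, hTcard, ψ, hψ0, hψ1, hbad⟩ :=
    exists_almost_periods A U W' W' hA hU hAU f hf0 hf1 k hk hδ
  have hT : T.Nonempty := by
    rw [nonempty_iff_ne_empty]
    rintro rfl
    have : 0 < (#U : ℝ) * #A ^ k := by positivity
    simp at hTcard
    linarith
  refine ⟨T, hTU, hT, hTcard, fun B hB => ?_⟩
  set φ := avgTranslate A f with hφ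
  have hφ0 := avgTranslate_nonneg A hf0
  have hφ1 := avgTranslate_le_one A hf1
  set h := smooth A φ with hh
  set φ' : G → ℝ := fun x => φ x * ind W' x with hφ'
  have hφ'le : ∀ x, φ' x ≤ φ x := fun x =>
    mul_le_of_le_one_right (hφ0 x) (ind_le_one W' x)
  have hφ'0 : ∀ x, 0 ≤ φ' x := fun x => mul_nonneg (hφ0 x) (ind_nonneg W' x)
  set h' := smooth A φ' with hh'
  have hle : ∀ t, h' t ≤ h t := by
    intro t
    simp only [hh, hh', smooth]
    gcongr
    exact hφ'le _
  have heq : ∀ i ≤ r, ∀ t ∈ V i, h' t = h t := by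
    intro i hi t ht
    simp only [hh, hh', smooth]
    congr 1
    refine sum_congr rfl fun y hy => ?_
    simp [hφ', ind, hVA i hi t ht y hy]
  have hzero : 999 / 1000 ≤ h 0 := by
    have h1 : h 0 = (∑ y ∈ A, ∑ x ∈ A, f (x - y)) / #A ^ 2 := by
      simp only [hh, smooth, hφ, avgTranslate]
      rw [← sum_div, div_div, sq]
      simp [sub_eq_add_neg]
    rw [h1, le_div_iff₀ (by positivity), sum_comm]
    have h2 : ∑ x ∈ A, ∑ y ∈ A, (if x - y ∈ S then (0 : ℝ) else 1) =
        #A ^ 2 - ∑ x ∈ A, ∑ y ∈ A, f (x - y) := by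
      have h3 : ∀ z, (if z ∈ S then (0 : ℝ) else 1) = 1 - f z := by
        intro z; simp only [hf, ind]; split_ifs <;> simp
      simp_rw [h3, sum_sub_distrib]
      simp [sq]
    linarith
  have hshift : ∀ i < r, ∀ t ∈ V i, ∀ u ∈ T, ∀ u' ∈ T, |h' (t + u - u') - h' t| ≤ 2 * (δ + β) := by
    intro i hi t ht u hu u' hu'
    have ht' := hV i t ht u (hTU hu) u' (hTU hu')
    rw [heq i hi.le t ht, heq (i + 1) hi _ ht']
    exact smooth_shift_close A W' hA φ ψ hφ0 hφ1 hψ0 hψ1 hδ.le u u' t ((hbad u hu).trans hβ)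
      ((hbad u' hu').trans hβ) (hVA i hi.le t ht) (hVA (i + 1) hi _ ht')
  have hM0 := avgDiff_iterate_close T hT h' V r (2 * (δ + β))
    (fun i t ht u hu u' hu' => hV i t ht u (hTU hu) u' (hTU hu')) hshift r 0 (by omega) 0 hV0
  rw [heq 0 (by omega) 0 hV0] at hM0
  have hlow : ∀ t ∈ B, 99 / 100 ≤ (avgDiff T)^[r] h t := by
    intro t ht
    have h1 := bootstrap A W' T hA φ' hφ'0 (fun x => (hφ'le x).trans (hφ1 x))
      (fun x hx => by simp [hφ', ind, hx]) r t hν (hB t ht)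
    have h2 := avgDiff_iterate_mono T hle r t
    have h3 := (abs_le.1 h1).1
    have h4 := (abs_le.1 hM0).1
    linarith
  obtain ⟨z, -, hz⟩ := exists_max_image (univ : Finset G) (fun z => ∑ t ∈ B, f (z + t)) univ_nonempty
  refine ⟨z, ?_⟩
  have hC : ∀ w, ∑ t ∈ B, f (w + t) ≤ ∑ t ∈ B, f (z + t) := fun w => hz w (mem_univ _)
  have h1 := sum_avgDiff_iterate_le T B hT h
    (sum_smooth_le A B hA φ (sum_avgTranslate_le A B hA f hC)) r 0
  have h2 : ∑ t ∈ B, f (z + t) = #{t ∈ B | z + t ∈ S} := by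
    simp [hf, ind]
  rw [h2] at h1
  refine le_trans ?_ h1
  calc 99 / 100 * (#B : ℝ) = ∑ t ∈ B, (99 / 100 : ℝ) := by simp; ring
    _ ≤ _ := sum_le_sum fun t ht => by simpa using hlow t ht

lemma corr_ind_eq (A B : Finset G) (x : G) : corr (ind A) (ind B) x = #{s ∈ A | s + x ∈ B} := by
  simp only [corr, ind, ite_mul, one_mul, zero_mul, sum_ite_mem, univ_inter]
  simp

lemma conv_ind_eq (A B : Finset G) (x : G) : conv (ind A) (ind B) x = #{s ∈ A | x - s ∈ B} := by
  simp only [conv, ind, ite_mul, one_mul, zero_mul, sum_ite_mem, univ_inter]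
  simp

/-- A translate on which a difference convolution is often large yields a density increment. -/
lemma exists_increment_of_corr (A B : Finset G) (hA : A.Nonempty) {θ : ℝ} (hθ : 0 ≤ θ) (z : G)
    (h : 99 / 100 * (#B : ℝ) ≤ #{t ∈ B | θ ≤ corr (ind A) (ind A) (z + t)}) :
    ∃ x, 99 / 100 * θ * #B ≤ #A * (#{t ∈ B | x + t ∈ A} : ℝ) := by
  have h1 : 99 / 100 * θ * #B ≤ ∑ t ∈ B, corr (ind A) (ind A) (z + t) := by
    calc 99 / 100 * θ * #B = (99 / 100 * #B) * θ := by ring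
      _ ≤ #{t ∈ B | θ ≤ corr (ind A) (ind A) (z + t)} * θ := by gcongr
      _ = ∑ t ∈ B with θ ≤ corr (ind A) (ind A) (z + t), θ := by simp
      _ ≤ ∑ t ∈ B with θ ≤ corr (ind A) (ind A) (z + t), corr (ind A) (ind A) (z + t) :=
          sum_le_sum fun t ht => (mem_filter.1 ht).2
      _ ≤ _ := sum_le_sum_of_subset_of_nonneg (filter_subset _ _) fun t _ _ => by
          rw [corr_ind_eq]; positivity
  have h2 : ∑ t ∈ B, corr (ind A) (ind A) (z + t) =
      ∑ s ∈ A, (#{t ∈ B | s + z + t ∈ A} : ℝ) := by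
    simp_rw [corr_ind_eq]
    have := sum_card_bipartiteAbove_eq_sum_card_bipartiteBelow (s := B) (t := A)
      (fun t s => s + (z + t) ∈ A)
    simp only [bipartiteAbove, bipartiteBelow, ← add_assoc] at this ⊢
    exact_mod_cast this
  obtain ⟨s, -, hs⟩ := exists_le_of_sum_le hA (f := fun _ => 99 / 100 * θ * #B / #A)
    (g := fun s => (#{t ∈ B | s + z + t ∈ A} : ℝ)) (by
      rw [← h2, sum_const, nsmul_eq_mul, mul_div_cancel₀ _ (by exact_mod_cast hA.card_pos.ne')]
      exact h1)
  refine ⟨s + z, ?_⟩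
  have hA0 : (0 : ℝ) < #A := by exact_mod_cast hA.card_pos
  rw [div_le_iff₀ hA0] at hs
  linarith

end Increment

section Moments

variable {G : Type*} [AddCommGroup G] [Fintype G] [DecidableEq G]

lemma conv_comm (f g : G → ℝ) (x : G) : conv f g x = conv g f x := by
  unfold conv
  rw [← Equiv.sum_comp (Equiv.subLeft x)]
  exact sum_congr rfl fun s _ => by simp [mul_comm]

lemma corr_neg (f g : G → ℝ) (x : G) : corr f g (-x) = corr g f x := by
  unfold corr
  rw [← Equiv.sum_comp (Equiv.addRight x)]
  exact sum_congr rfl fun s _ => by simp [mul_comm]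

lemma conv_sub_smul (f g : G → ℝ) (a : ℝ) (x : G) :
    conv (fun y => f y - a * g y) (fun y => f y - a * g y) x =
      conv f f x - 2 * a * conv f g x + a ^ 2 * conv g g x := by
  have h : conv (fun y => f y - a * g y) (fun y => f y - a * g y) x =
      conv f f x - a * conv f g x - a * conv g f x + a ^ 2 * conv g g x := by
    simp only [conv, mul_sum, ← sum_sub_distrib, ← sum_add_distrib]
    exact sum_congr rfl fun s _ => by ring
  rw [h, conv_comm g f]
  ring

lemma corr_sub_smul (f g : G → ℝ) (a : ℝ) (x : G) :
    corr (fun y => f y - a * g y) (fun y => f y - a * g y) x =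
      corr f f x - a * corr f g x - a * corr f g (-x) + a ^ 2 * corr g g x := by
  rw [corr_neg f g]
  simp only [corr, mul_sum, ← sum_sub_distrib, ← sum_add_distrib]
  exact sum_congr rfl fun s _ => by ring

lemma card_filter_map_mem_ge {A B B' : Finset G} {κ : ℝ} (hB : B ⊆ B')
    (hcard : (#B' : ℝ) ≤ (1 + κ) * #B) (f : G → G) (hf : Function.Injective f)
    (hfA : ∀ s ∈ A, f s ∈ B') : (#A : ℝ) - κ * #B ≤ #{s ∈ A | f s ∈ B} := by
  have h1 : #{s ∈ A | ¬ f s ∈ B} ≤ #(B' \ B) :=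
    card_le_card_of_injOn f (fun s hs => by
      have := mem_filter.1 hs
      exact mem_sdiff.2 ⟨hfA s this.1, this.2⟩) hf.injOn
  have h2 : #(B' \ B) + #B = #B' := card_sdiff_add_card_eq_card hB
  have h3 := card_filter_add_card_filter_not (s := A) (fun s => f s ∈ B)
  have h1' : (#{s ∈ A | ¬ f s ∈ B} : ℝ) ≤ #(B' \ B) := by exact_mod_cast h1
  have h2' : (#(B' \ B) : ℝ) + #B = #B' := by exact_mod_cast h2
  have h3' : (#{s ∈ A | f s ∈ B} : ℝ) + #{s ∈ A | ¬ f s ∈ B} = #A := by exact_mod_cast h3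
  linarith

/-- Few solutions to `x + y = c` force the balanced function to have large even moments. -/
lemma balanced_moment_ge {A B B' W C E : Finset G} {α κ : ℝ} (hAB : A ⊆ B) (hB : B ⊆ B')
    (hα : α * #B = #A) (hα0 : 0 < α) (hκ : κ ≤ α / 200) (hcard : (#B' : ℝ) ≤ (1 + κ) * #B)
    (hbig : 8 ≤ α ^ 2 * #B) (hWneg : ∀ w ∈ W, -w ∈ W)
    (hC : ∀ c ∈ C, conv (ind A) (ind A) c ≤ 1) (hCB : ∀ c ∈ C, ∀ b ∈ B, c - b ∈ B')
    (hCE : ∀ c ∈ C, ∀ w ∈ W, ∀ w' ∈ W, c - w + w' ∈ E) (hC0 : C.Nonempty) {p : ℕ} (hp : Even p)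
    (hE : (#E : ℝ) ≤ (3 / 2) ^ p * #C) :
    #W ^ 2 * (1 / 2 * (α ^ 2 * #B)) ^ p ≤ ∑ w ∈ W, ∑ w' ∈ W,
      corr (fun y => ind A y - α * ind B y) (fun y => ind A y - α * ind B y) (w - w') ^ p := by
  set g : G → ℝ := fun y => ind A y - α * ind B y with hg
  set M := α ^ 2 * #B with hM
  have hconv : ∀ c ∈ C, conv g g c ≤ -(3 / 4 * M) := by
    intro c hc
    rw [hg, conv_sub_smul]
    have h1 : (#A : ℝ) - κ * #B ≤ conv (ind A) (ind B) c := by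
      rw [conv_ind_eq]
      exact card_filter_map_mem_ge hB hcard (fun s => c - s) sub_right_injective
        fun s hs => hCB c hc s (hAB hs)
    have h2 : conv (ind B) (ind B) c ≤ #B := by
      rw [conv_ind_eq]; exact_mod_cast card_filter_le _ _
    have h3 := hC c hc
    have h4 : 2 * α * (#A - κ * #B) ≤ 2 * α * conv (ind A) (ind B) c := by gcongr
    have h5 : α ^ 2 * conv (ind B) (ind B) c ≤ M := by rw [hM]; gcongr
    have h6 : κ * (α * #B) ≤ α / 200 * (α * #B) := by gcongr
    have h7 : α * #A = M := by rw [← hα, hM]; ring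
    have h8 : α / 200 * (α * #B) = M / 200 := by rw [hM]; ring
    nlinarith
  have hM0 : 0 < M := by linarith
  have hterm : ∀ w ∈ W, ∀ w' ∈ W, #C * (3 / 4 * M) ^ p ≤ ∑ t ∈ E, conv g g (t + w - w') ^ p := by
    intro w hw w' hw'
    calc #C * (3 / 4 * M) ^ p = ∑ c ∈ C, (3 / 4 * M) ^ p := by simp
      _ ≤ ∑ c ∈ C, conv g g c ^ p := by
          refine sum_le_sum fun c hc => ?_
          rw [← hp.neg_pow (conv g g c)]
          have := hconv c hc
          gcongr
          linarith
      _ = ∑ t ∈ C.image (fun c => c - w + w'), conv g g (t + w - w') ^ p := by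
          rw [sum_image]
          · exact sum_congr rfl fun c _ => by congr 2; abel
          · intro a _ b _ h
            simpa using h
      _ ≤ _ := sum_le_sum_of_subset_of_nonneg
          (image_subset_iff.2 fun c hc => hCE c hc w hw w' hw') fun t _ _ => hp.pow_nonneg _
  rcases W.eq_empty_or_nonempty with rfl | hW
  · simp
  have hE0 : E.Nonempty := by
    obtain ⟨c, hc⟩ := hC0
    obtain ⟨w, hw⟩ := hW
    exact ⟨_, hCE c hc w hw w hw⟩
  obtain ⟨t, -, ht⟩ := exists_le_of_sum_le hE0
    (f := fun _ => (#W : ℝ) ^ 2 * (1 / 2 * M) ^ p)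
    (g := fun t => ∑ w ∈ W, ∑ w' ∈ W, conv g g (t + w - w') ^ p) (by
      rw [sum_comm]
      calc ∑ t ∈ E, (#W : ℝ) ^ 2 * (1 / 2 * M) ^ p
          = #E * (#W ^ 2 * (1 / 2 * M) ^ p) := by simp
        _ ≤ ((3 / 2) ^ p * #C) * (#W ^ 2 * (1 / 2 * M) ^ p) := by gcongr
        _ = #W ^ 2 * (#C * (3 / 4 * M) ^ p) := by
            rw [show 3 / 4 * M = 3 / 2 * (1 / 2 * M) by ring, mul_pow (3 / 2 : ℝ)]; ring
        _ = ∑ w ∈ W, ∑ w' ∈ W, (#C * (3 / 4 * M) ^ p) := by simp; ring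
        _ ≤ ∑ w ∈ W, ∑ w' ∈ W, ∑ t ∈ E, conv g g (t + w - w') ^ p :=
            sum_le_sum fun w hw => sum_le_sum fun w' hw' => hterm w hw w' hw'
        _ = _ := by
            refine sum_congr rfl fun w _ => ?_
            rw [sum_comm])
  exact ht.trans (sum_conv_pow_le g W hWneg p t)

lemma abs_one_add_corr_le {A B B' : Finset G} {α κ : ℝ} (hAB : A ⊆ B) (hB : B ⊆ B')
    (hα : α * #B = #A) (hα0 : 0 < α) (hκ : κ ≤ α / 200)
    (hcard : (#B' : ℝ) ≤ (1 + κ) * #B) (hM0 : 0 < α ^ 2 * #B) (x : G)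
    (hx : ∀ b ∈ B, b + x ∈ B') (hx' : ∀ b ∈ B, b + -x ∈ B') :
    |1 + corr (fun y => ind A y - α * ind B y) (fun y => ind A y - α * ind B y) x /
      (α ^ 2 * #B)| ≤ corr (ind A) (ind A) x / (α ^ 2 * #B) + 1 / 100 := by
  have hlow : ∀ A₁ ⊆ B, ∀ y, (∀ b ∈ B, b + y ∈ B') →
      (#A₁ : ℝ) - κ * #B ≤ corr (ind A₁) (ind B) y := by
    intro A₁ hA₁ y hy
    rw [corr_ind_eq]
    exact card_filter_map_mem_ge hB hcard (fun s => s + y) (add_left_injective _)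
      fun s hs => hy s (hA₁ hs)
  have hup : ∀ A₁ : Finset G, ∀ y, corr (ind A₁) (ind B) y ≤ #A₁ := by
    intro A₁ y
    rw [corr_ind_eq]
    exact_mod_cast card_filter_le _ _
  have e1 := hlow A hAB x hx
  have e2 := hlow A hAB (-x) hx'
  have e3 := hlow B subset_rfl x hx
  have f1 := hup A x
  have f2 := hup A (-x)
  have f3 := hup B x
  have hc0 : 0 ≤ corr (ind A) (ind A) x := by rw [corr_ind_eq]; positivity
  have hB0 : (0 : ℝ) < #B := pos_of_mul_pos_right hM0 (by positivity)
  have hα1 : α ≤ 1 := by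
    have : (#A : ℝ) ≤ #B := by exact_mod_cast card_le_card hAB
    by_contra! h
    nlinarith
  rw [corr_sub_smul]
  generalize corr (ind A) (ind B) x = a at *
  generalize corr (ind A) (ind B) (-x) = b at *
  generalize corr (ind B) (ind B) x = c at *
  generalize corr (ind A) (ind A) x = d at *
  have h7 : α * #A = α ^ 2 * #B := by rw [← hα]; ring
  have hk : κ * (α * #B) ≤ α / 200 * (α * #B) := by gcongr
  have g1 : α * (#A - κ * #B) ≤ α * a := by gcongr
  have g2 : α * (#A - κ * #B) ≤ α * b := by gcongr
  have g3 : α ^ 2 * (#B - κ * #B) ≤ α ^ 2 * c := by gcongr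
  have g4 : α * a ≤ α * #A := by gcongr
  have g5 : α * b ≤ α * #A := by gcongr
  have g6 : α ^ 2 * c ≤ α ^ 2 * #B := by gcongr
  have g7 : κ * (α ^ 2 * #B) ≤ 1 / 200 * (α ^ 2 * #B) := by gcongr; linarith
  set M := α ^ 2 * #B with hM
  have g8 : α ^ 2 * (#B - κ * #B) = M - κ * M := by rw [hM]; ring
  have g9 : α * (#A - κ * #B) = M - κ * (α * #B) := by rw [← h7]; ring
  have g10 : α / 200 * (α * #B) = M / 200 := by rw [hM]; ring
  have hd : 1 + (d - α * a - α * b + α ^ 2 * c) / M =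
      d / M + (M - α * a - α * b + α ^ 2 * c) / M := by field_simp; ring
  have habs : |(M - α * a - α * b + α ^ 2 * c) / M| ≤ 1 / 100 := by
    rw [abs_div, abs_of_pos hM0, div_le_iff₀ hM0, abs_le]
    constructor <;> linarith
  rw [hd]
  have hd0 : |d / M + (M - α * a - α * b + α ^ 2 * c) / M| ≤
      |d / M| + |(M - α * a - α * b + α ^ 2 * c) / M| := abs_add_le _ _
  rw [abs_of_nonneg (div_nonneg ?_ hM0.le : 0 ≤ d / M)] at hd0
  · linarith
  · assumption

/-- Few solutions to `x + y = c` force the difference convolution of `A` to be large on average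
over differences of a suitable dense subset of `W`. -/
lemma exists_sifted {A B B' W C E : Finset G} {α κ : ℝ} (hAB : A ⊆ B) (hB : B ⊆ B')
    (hα : α * #B = #A) (hα0 : 0 < α) (hκ : κ ≤ α / 200)
    (hcard : (#B' : ℝ) ≤ (1 + κ) * #B)
    (hbig : 8 ≤ α ^ 2 * #B) (hW : W.Nonempty) (hWneg : ∀ w ∈ W, -w ∈ W)
    (hWB : ∀ w ∈ W, ∀ w' ∈ W, ∀ b ∈ B, b + (w - w') ∈ B')
    (hC : ∀ c ∈ C, conv (ind A) (ind A) c ≤ 1) (hCB : ∀ c ∈ C, ∀ b ∈ B, c - b ∈ B')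
    (hCE : ∀ c ∈ C, ∀ w ∈ W, ∀ w' ∈ W, c - w + w' ∈ E) (hC0 : C.Nonempty) {p : ℕ} (hp : Even p)
    (hp18 : 18 ≤ p) (hE : (#E : ℝ) ≤ (3 / 2) ^ p * #C) :
    ∃ A' ⊆ W, A'.Nonempty ∧ 1 / 2 * α ^ (8 * p) * #W ≤ #A' ∧
      ∑ x ∈ A', ∑ y ∈ A', (if corr (ind A) (ind A) (x - y) < 17 / 16 * (α ^ 2 * #B) then (1 : ℝ)
        else 0) ≤ 1 / 1000 * #A' ^ 2 := by
  have hmom := balanced_moment_ge hAB hB hα hα0 hκ hcard hbig hWneg hC hCB hCE hC0 hp hE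
  set g : G → ℝ := fun y => ind A y - α * ind B y with hg
  set M := α ^ 2 * #B with hM
  have hM0 : 0 < M := by linarith
  have h7 : α * #A = M := by rw [← hα, hM]; ring
  have hcorr : ∀ x, 0 ≤ corr (ind A) (ind A) x := fun x => by rw [corr_ind_eq]; positivity
  have hsplit : ∀ f : G → ℝ, ∑ i ∈ W ×ˢ W, f (i.1 - i.2) = ∑ w ∈ W, ∑ w' ∈ W, f (w - w') :=
    fun f => sum_product _ _ _
  have hclose : ∀ i ∈ W ×ˢ W, |1 + corr g g (i.1 - i.2) / M| ≤
      corr (ind A) (ind A) (i.1 - i.2) / M + 1 / 100 := by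
    rintro ⟨w, w'⟩ hi
    obtain ⟨hw, hw'⟩ := mem_product.1 hi
    simp only at hw hw' ⊢
    refine abs_one_add_corr_le hAB hB hα hα0 hκ hcard hM0 _ (hWB w hw w' hw') ?_
    rw [neg_sub]
    exact hWB w' hw' w hw
  have hpow : ∀ j, ∑ i ∈ W ×ˢ W, (corr g g (i.1 - i.2) / M) ^ j =
      (∑ w ∈ W, ∑ w' ∈ W, corr g g (w - w') ^ j) / M ^ j := by
    intro j
    rw [hsplit (fun x => (corr g g x / M) ^ j)]
    simp_rw [div_pow, sum_div]
  have hunb := unbalancing (W ×ˢ W) (fun i => corr g g (i.1 - i.2) / M) p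
    (fun j => by
      rw [hpow]; exact div_nonneg (sum_corr_pow_nonneg g W j) (by positivity))
    (by
      rw [hpow, le_div_iff₀ (by positivity), card_product]
      push_cast
      calc (#W : ℝ) * #W * (1 / 2) ^ p * M ^ p = #W ^ 2 * (1 / 2 * M) ^ p := by
            rw [mul_pow]; ring
        _ ≤ _ := hmom)
  have hmom2 := moment_of_approx (W ×ˢ W) (fun i => corr g g (i.1 - i.2) / M)
    (fun i => corr (ind A) (ind A) (i.1 - i.2) / M) p (by omega)
    (fun i _ => div_nonneg (hcorr _) hM0.le) hclose hunb
  rw [hsplit (fun x => (corr (ind A) (ind A) x / M) ^ (8 * p)), card_product] at hmom2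
  simp_rw [div_pow, ← sum_div] at hmom2
  rw [← div_pow, le_div_iff₀ (by positivity)] at hmom2
  obtain ⟨A', h1, h2, h3, h4⟩ := sifting A W (8 * p) (H := 9 / 8 * M) (θ := 17 / 16 * M)
    (δ := (17 / 18) ^ (8 * p)) (η := 1 / 2 * α ^ (8 * p)) hW (by positivity) (by positivity)
    (by positivity) (by
      push_cast at hmom2
      rw [mul_pow (9 / 8 : ℝ)]
      nlinarith)
    (by rw [← mul_pow]; apply le_of_eq; congr 1; ring)
    (by
      rw [mul_assoc, ← mul_pow, h7, mul_pow (9 / 8 : ℝ)]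
      have : (1 : ℝ) ≤ (9 / 8) ^ (8 * p) := one_le_pow₀ (by norm_num)
      have : 0 < M ^ (8 * p) := by positivity
      nlinarith)
  refine ⟨A', h1, h2, h3, h4.trans ?_⟩
  gcongr
  have : ((17 : ℝ) / 18) ^ (8 * p) ≤ (17 / 18) ^ 144 :=
    pow_le_pow_of_le_one (by norm_num) (by norm_num) (by omega)
  have h5 : ((17 : ℝ) / 18) ^ 144 ≤ 1 / 3000 := by norm_num
  linarith

end Moments

section Parameters

/-- Logarithmic loss in the density of the sifted set. -/
def siftLoss (L : ℕ) : ℕ := L * (8 * (4 * L + 18)) + 1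

/-- Number of smoothing steps. -/
def smoothSteps (L : ℕ) : ℕ := siftLoss L + 9

/-- Number of samples used to find almost periods. -/
def sampleSize (L : ℕ) : ℕ := 2 * (800 * smoothSteps L) ^ 2 * (siftLoss L + 10 + smoothSteps L)

/-- Increase of the rank of the Bohr set in one density increment. -/
def rankLoss (L : ℕ) : ℕ := 8 * ((siftLoss L + 1) * sampleSize L + 3)

/-- Precision of the annihilation of the large spectrum. -/
noncomputable def specTol (L : ℕ) : ℝ := Real.exp (-(siftLoss L + 8))

/-- Regularity parameter of the Bohr sets. -/
noncomputable def regTol (L : ℕ) : ℝ := Real.exp (-(rankLoss L + siftLoss L + 11))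

lemma exp_one_ge : (2.7 : ℝ) ≤ Real.exp 1 := by linarith [Real.exp_one_gt_d9]

lemma exp_nat_ge (n : ℕ) : (2.7 : ℝ) ^ n ≤ Real.exp n := by
  rw [← Real.exp_one_pow]
  have := exp_one_ge
  gcongr

lemma two_mul_exp_le (L : ℕ) : 2 * Real.exp L ≤ (3 / 2) ^ (4 * L + 18) := by
  rw [pow_add, pow_mul, ← Real.exp_one_pow]
  have h1 : Real.exp 1 ^ L ≤ ((3 / 2 : ℝ) ^ 4) ^ L := by
    have := Real.exp_one_lt_d9
    gcongr
    norm_num at *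
    linarith
  have h2 : (2 : ℝ) ≤ (3 / 2) ^ 18 := by norm_num
  have h3 : (0 : ℝ) ≤ ((3 / 2 : ℝ) ^ 4) ^ L := by positivity
  nlinarith

lemma regTol_pos (L : ℕ) : 0 < regTol L := Real.exp_pos _

lemma specTol_pos (L : ℕ) : 0 < specTol L := Real.exp_pos _

lemma regTol_le_one (L : ℕ) : regTol L ≤ 1 := by
  unfold regTol
  rw [Real.exp_le_one_iff]
  have : (0 : ℝ) ≤ rankLoss L + siftLoss L + 11 := by positivity
  linarith

lemma le_siftLoss (L : ℕ) : L ≤ siftLoss L := by unfold siftLoss; nlinarith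

lemma regTol_le (L : ℕ) : regTol L ≤ Real.exp (-L) / 200 := by
  have h0 : (L : ℝ) ≤ siftLoss L := by exact_mod_cast le_siftLoss L
  have h1 : regTol L ≤ Real.exp (-L + -(11 : ℕ)) := by
    unfold regTol
    have : (0 : ℝ) ≤ rankLoss L := by positivity
    gcongr
    push_cast
    linarith
  rw [Real.exp_add, Real.exp_neg (11 : ℕ)] at h1
  refine h1.trans ?_
  rw [div_eq_mul_inv]
  have := exp_nat_ge 11
  gcongr
  refine le_trans ?_ this
  norm_num

lemma four_mul_regTol_le (L : ℕ) : 4 * regTol L * Real.exp (rankLoss L + 1) ≤ specTol L := by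
  unfold regTol specTol
  rw [mul_assoc, ← Real.exp_add, show (-((rankLoss L : ℝ) + siftLoss L + 11) + (rankLoss L + 1)) =
    -(siftLoss L + 8) + -(2 : ℕ) by push_cast; ring, Real.exp_add, Real.exp_neg (2 : ℕ)]
  have h := exp_nat_ge 2
  have h2 : (Real.exp (2 : ℕ))⁻¹ ≤ 4⁻¹ := by
    gcongr
    refine le_trans ?_ h
    norm_num
  have := Real.exp_pos (-(siftLoss L + 8 : ℝ))
  nlinarith

lemma specTol_add_le (L : ℕ) :
    (specTol L + 2 * (1 / 4) ^ smoothSteps L) * Real.exp (siftLoss L + 1) ≤ 1 / 250 := by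
  have h1 : specTol L * Real.exp (siftLoss L + 1) = (Real.exp (7 : ℕ))⁻¹ := by
    unfold specTol
    rw [← Real.exp_add, ← Real.exp_neg]
    congr 1; push_cast; ring
  have h2 : (1 / 4 : ℝ) ^ smoothSteps L ≤ Real.exp (-smoothSteps L) := by
    rw [Real.exp_neg, ← Real.exp_one_pow, one_div, inv_pow]
    have := Real.exp_one_lt_d9
    gcongr
    linarith
  have h3 : Real.exp (-smoothSteps L) * Real.exp (siftLoss L + 1) = (Real.exp (8 : ℕ))⁻¹ := by
    unfold smoothSteps
    rw [← Real.exp_add, ← Real.exp_neg]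
    congr 1; push_cast; ring
  have h4 : (Real.exp (7 : ℕ))⁻¹ ≤ 1 / 1000 := by
    rw [one_div]; gcongr; exact le_trans (by norm_num) (exp_nat_ge 7)
  have h5 : (Real.exp (8 : ℕ))⁻¹ ≤ 1 / 1000 := by
    rw [one_div]; gcongr; exact le_trans (by norm_num) (exp_nat_ge 8)
  have h6 := Real.exp_pos (siftLoss L + 1 : ℝ)
  nlinarith

lemma smoothSteps_pos (L : ℕ) : 0 < smoothSteps L := by unfold smoothSteps; omega

lemma sampleSize_pos (L : ℕ) : 0 < sampleSize L := by
  have := smoothSteps_pos L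
  unfold sampleSize; positivity

lemma sampling_error_le (L : ℕ) :
    4 * Real.exp (-(sampleSize L * (1 / (800 * smoothSteps L) : ℝ) ^ 2 / 2)) *
      Real.exp (siftLoss L + 1) ≤ 1 / (800 * smoothSteps L) := by
  have hr : (0 : ℝ) < smoothSteps L := by exact_mod_cast smoothSteps_pos L
  have h1 : (sampleSize L : ℝ) * (1 / (800 * smoothSteps L) : ℝ) ^ 2 / 2 =
      siftLoss L + 10 + smoothSteps L := by
    unfold sampleSize
    push_cast
    field_simp
  rw [h1, mul_assoc, ← Real.exp_add, show -((siftLoss L : ℝ) + 10 + smoothSteps L) +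
    (siftLoss L + 1) = -((9 : ℕ) + smoothSteps L) by push_cast; ring, Real.exp_neg, Real.exp_add]
  have h2 : (2.7 : ℝ) ^ 9 ≤ Real.exp (9 : ℕ) := exp_nat_ge 9
  have h3 : (smoothSteps L : ℝ) ≤ Real.exp (smoothSteps L) := by
    linarith [Real.add_one_le_exp (smoothSteps L : ℝ)]
  have h4 : (3200 : ℝ) * smoothSteps L ≤ Real.exp (9 : ℕ) * Real.exp (smoothSteps L) := by
    have h5 : (3200 : ℝ) ≤ Real.exp (9 : ℕ) := le_trans (by norm_num) h2
    gcongr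
  rw [← div_eq_mul_inv, div_le_div_iff₀ (by positivity) (by positivity)]
  linarith

end Parameters

section DensityIncrement

variable {G : Type*} [AddCommGroup G] [Fintype G] [DecidableEq G]

/-- The density increment step, relative to an abstract system of nested approximate groups. -/
lemma exists_density_increment {A B B' C E W W' U U' U₂ U₂' : Finset G} {α : ℝ} (L : ℕ)
    (hAB : A ⊆ B) (hB : B ⊆ B') (hα : α * #B = #A) (hα0 : Real.exp (-L) ≤ α)
    (hcard : (#B' : ℝ) ≤ (1 + regTol L) * #B) (hbig : 8 ≤ α ^ 2 * #B)
    (hW : W.Nonempty) (hWneg : ∀ w ∈ W, -w ∈ W)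
    (hWB : ∀ w ∈ W, ∀ w' ∈ W, ∀ b ∈ B, b + (w - w') ∈ B')
    (hC : ∀ c ∈ C, conv (ind A) (ind A) c ≤ 1) (hCB : ∀ c ∈ C, ∀ b ∈ B, c - b ∈ B')
    (hCE : ∀ c ∈ C, ∀ w ∈ W, ∀ w' ∈ W, c - w + w' ∈ E) (hC0 : C.Nonempty)
    (hE : (#E : ℝ) ≤ 2 * Real.exp L * #C)
    (hW' : (#W' : ℝ) ≤ 2 * #W) (hU : U.Nonempty) (hWU : ∀ w ∈ W, ∀ u ∈ U, w + u ∈ W')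
    (V : ℕ → Finset G) (hV0 : 0 ∈ V 0)
    (hV : ∀ i, ∀ t ∈ V i, ∀ u ∈ U, ∀ u' ∈ U, t + u - u' ∈ V (i + 1))
    (hVW : ∀ i ≤ smoothSteps L, ∀ t ∈ V i, ∀ w ∈ W, t - w ∈ W')
    (hU' : (#U' : ℝ) ≤ 2 * #U) (hU₂ : U₂.Nonempty) (hUU₂ : ∀ t ∈ U, ∀ u ∈ U₂, t + u ∈ U')
    (hsub : U₂ ⊆ U₂') (hU₂' : (#U₂' : ℝ) ≤ (1 + regTol L) * #U₂) :
    ∃ Λ : Finset (AddChar G ℂ), #Λ ≤ rankLoss L ∧ ∀ D : Finset G,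
      (∀ t ∈ D, (∀ u ∈ U₂, u + t ∈ U₂') ∧ ∀ l ∈ Λ, rankLoss L * ‖l t - 1‖ ≤ specTol L / 2) →
      ∃ x, 21 / 20 * α * #D ≤ #{t ∈ D | x + t ∈ A} := by
  have hα1 : 0 < α := (Real.exp_pos _).trans_le hα0
  have hp18 : 18 ≤ 4 * L + 18 := by omega
  obtain ⟨A', hA'W, hA', hA'card, hsift⟩ := exists_sifted hAB hB hα hα1
    ((regTol_le L).trans (by linarith)) hcard hbig hW hWneg hWB hC hCB hCE hC0
    (p := 4 * L + 18) ⟨2 * L + 9, by ring⟩ hp18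
    (hE.trans (by gcongr; exact two_mul_exp_le L))
  set θ := 17 / 16 * (α ^ 2 * #B) with hθ
  have hW0 : (0 : ℝ) < #W := by exact_mod_cast hW.card_pos
  have hA'0 : (0 : ℝ) < #A' := by exact_mod_cast hA'.card_pos
  have hratio : (#W' : ℝ) ≤ Real.exp (siftLoss L + 1) * #A' := by
    have h1 : Real.exp (-(siftLoss L : ℝ)) ≤ 1 / 2 * α ^ (8 * (4 * L + 18)) := by
      have h2 : (siftLoss L : ℝ) = ((8 * (4 * L + 18) : ℕ) : ℝ) * L + 1 := by
        unfold siftLoss; push_cast; ring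
      rw [h2, neg_add, Real.exp_add, mul_comm, ← mul_neg, Real.exp_nat_mul]
      have h3 : Real.exp (-1) ≤ 1 / 2 := by
        rw [Real.exp_neg, one_div]; gcongr; linarith [exp_one_ge]
      gcongr
    have h4 : Real.exp (-(siftLoss L : ℝ)) * #W ≤ #A' := le_trans (by gcongr) hA'card
    rw [Real.exp_neg, inv_mul_le_iff₀ (Real.exp_pos _)] at h4
    rw [Real.exp_add]
    have h5 := exp_one_ge
    have h6 : 0 ≤ Real.exp (siftLoss L) * #A' := by positivity
    nlinarith
  set S : Finset G := {x | θ ≤ corr (ind A) (ind A) x} with hS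
  have hr : (0 : ℝ) < smoothSteps L := by exact_mod_cast smoothSteps_pos L
  obtain ⟨T, hTU, hT, hTcard, hT'⟩ := exists_dense_translate hA' hU S (by
      refine le_of_eq_of_le ?_ hsift
      refine sum_congr rfl fun x _ => sum_congr rfl fun y _ => ?_
      simp only [hS, mem_filter, mem_univ, true_and, ← not_lt]
      split_ifs <;> rfl) V hV0 hV (smoothSteps L) (sampleSize L) (sampleSize_pos L)
    (W' := W') (fun a ha u hu => hWU a (hA'W ha) u hu)
    (fun i hi t ht y hy => hVW i hi t ht y (hA'W hy))
    (δ := 1 / (800 * smoothSteps L)) (β := 1 / (800 * smoothSteps L)) (ν := specTol L)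
    (by positivity) (by
      calc 4 * Real.exp (-(sampleSize L * (1 / (800 * smoothSteps L) : ℝ) ^ 2 / 2)) * #W'
          ≤ 4 * Real.exp (-(sampleSize L * (1 / (800 * smoothSteps L) : ℝ) ^ 2 / 2)) *
            (Real.exp (siftLoss L + 1) * #A') := by gcongr
        _ = (4 * Real.exp (-(sampleSize L * (1 / (800 * smoothSteps L) : ℝ) ^ 2 / 2)) *
            Real.exp (siftLoss L + 1)) * #A' := by ring
        _ ≤ _ := by
          gcongr
          exact sampling_error_le L)
    (by apply le_of_eq; field_simp; norm_num) (specTol_pos L).le (by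
      refine le_trans ?_ (specTol_add_le L)
      have := specTol_pos L
      gcongr
      rw [Real.sqrt_le_left (Real.exp_pos _).le, div_le_iff₀ hA'0]
      refine hratio.trans ?_
      gcongr
      refine le_self_pow₀ ?_ two_ne_zero
      rw [Real.one_le_exp_iff]
      positivity)
  have hU0 : (0 : ℝ) < #U := by exact_mod_cast hU.card_pos
  have hτ : 1 / 4 * Real.exp (-((siftLoss L + 1) * sampleSize L)) * (#U' : ℝ) ≤ #T := by
    have h1 : (#U : ℝ) * #A' ^ sampleSize L ≤
        2 * #T * (Real.exp (siftLoss L + 1) * #A') ^ sampleSize L := hTcard.trans (by gcongr)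
    rw [mul_pow, ← mul_assoc, ← Real.exp_nat_mul] at h1
    have h2 := le_of_mul_le_mul_right h1 (by positivity)
    rw [Real.exp_neg, mul_comm (_ + _)]
    have h3 := Real.exp_pos (sampleSize L * (siftLoss L + 1 : ℝ))
    rw [mul_right_comm, ← div_eq_mul_inv, div_le_iff₀ h3]
    linarith
  obtain ⟨Λ, hΛ, hΛ'⟩ := exists_annihilator T U' U₂ U₂' hT hU₂
    (fun t ht u hu => hUU₂ t (hTU ht) u hu) hτ (rankLoss L) (by
      rw [mul_assoc, ← Real.exp_add]
      have h1 : ((3 : ℕ) : ℝ) ≤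
          -((siftLoss L + 1) * sampleSize L : ℝ) + ((rankLoss L : ℝ) + 1) / 8 := by
        unfold rankLoss; push_cast; linarith
      have h2 := (exp_nat_ge 3).trans (Real.exp_le_exp.2 h1)
      norm_num at h2
      linarith) hsub hU₂' (four_mul_regTol_le L)
  refine ⟨Λ, hΛ, fun D hD => ?_⟩
  obtain ⟨z, hz⟩ := hT' D fun t ht => hΛ' t (hD t ht).1 (hD t ht).2
  have hM : 0 < α ^ 2 * #B := by linarith
  have hB0 : (0 : ℝ) < #B := pos_of_mul_pos_right hM (by positivity)
  have hA0 : A.Nonempty := by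
    rw [← card_pos]
    have : (0 : ℝ) < #A := by rw [← hα]; positivity
    exact_mod_cast this
  obtain ⟨x, hx⟩ := exists_increment_of_corr A D hA0 (θ := θ) (by positivity) z (by
    simpa [hS] using hz)
  refine ⟨x, ?_⟩
  rw [← hα] at hx
  have h1 : (99 / 100 * (17 / 16) * α * #D : ℝ) ≤ #{t ∈ D | x + t ∈ A} := by
    refine le_of_mul_le_mul_left ?_ (mul_pos hα1 hB0)
    refine le_of_eq_of_le ?_ hx
    rw [hθ]; ring
  have h2 : 0 ≤ α * #D := by positivity
  linarith

end DensityIncrement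

section BohrIncrement

variable {G : Type*} [AddCommGroup G] [Fintype G] [DecidableEq G]

lemma le_sum_shift {X X' Y A : Finset G} {α κ : ℝ} (hXX' : X ⊆ X')
    (hcard : (#X' : ℝ) ≤ (1 + κ) * #X) (hα : α * #X ≤ #{x ∈ X | x ∈ A}) (hYne : Y.Nonempty)
    (hY : ∀ x ∈ X, ∀ y ∈ Y, x + y ∈ X') :
    (α - 2 * κ) * #X ≤ ∑ x ∈ X, (#{t ∈ Y | x + t ∈ A} : ℝ) / #Y := by
  have hY0 : (0 : ℝ) < #Y := by exact_mod_cast hYne.card_pos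
  have h1 : ∑ x ∈ X, ind A x = (#{x ∈ X | x ∈ A} : ℝ) := by
    simp [ind, filter_mem_eq_inter]
  have h2 : ∀ t ∈ Y, (α - 2 * κ) * #X ≤ ∑ x ∈ X, ind A (x + t) := by
    intro t ht
    have h := norm_sum_shift_sub_le X X' (ind A) (M := 1)
      (fun x => by rw [Real.norm_of_nonneg (ind_nonneg A x)]; exact ind_le_one A x)
      zero_le_one hXX' t (fun x hx => hY x hx t ht) hcard
    have h' := (abs_le.1 ((Real.norm_eq_abs _).symm.le.trans h)).1
    linarith
  rw [← sum_div, le_div_iff₀ hY0]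
  calc (α - 2 * κ) * #X * #Y = ∑ t ∈ Y, (α - 2 * κ) * #X := by simp; ring
    _ ≤ ∑ t ∈ Y, ∑ x ∈ X, ind A (x + t) := sum_le_sum h2
    _ = ∑ x ∈ X, (#{t ∈ Y | x + t ∈ A} : ℝ) := by
        rw [sum_comm]
        exact sum_congr rfl fun x _ => by simp [ind]

/-- Some translate has average density almost `α` on two smaller sets simultaneously. -/
lemma exists_shift_two_densities {X X' Y Z A : Finset G} {α κ : ℝ} (hX : X.Nonempty)
    (hXX' : X ⊆ X') (hcard : (#X' : ℝ) ≤ (1 + κ) * #X) (hα : α * #X ≤ #{x ∈ X | x ∈ A})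
    (hYne : Y.Nonempty) (hY : ∀ x ∈ X, ∀ y ∈ Y, x + y ∈ X') (hZne : Z.Nonempty)
    (hZ : ∀ x ∈ X, ∀ z ∈ Z, x + z ∈ X') :
    ∃ x, 2 * (α - 2 * κ) ≤ (#{t ∈ Y | x + t ∈ A} : ℝ) / #Y + (#{t ∈ Z | x + t ∈ A} : ℝ) / #Z := by
  obtain ⟨x, -, hx⟩ := exists_le_of_sum_le hX (f := fun _ => 2 * (α - 2 * κ))
    (g := fun x => (#{t ∈ Y | x + t ∈ A} : ℝ) / #Y + (#{t ∈ Z | x + t ∈ A} : ℝ) / #Z) (by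
      rw [sum_add_distrib, sum_const, nsmul_eq_mul]
      linarith [le_sum_shift hXX' hcard hα hYne hY, le_sum_shift hXX' hcard hα hZne hZ])
  exact ⟨x, hx⟩

lemma RegAt.card_le_two {Γ : Finset (AddChar G ℂ)} {ω κ ρ : ℝ} (h : RegAt Γ ω κ ρ) (hκ : κ ≤ 1) :
    (#(bohr Γ ((1 + ω) * ρ)) : ℝ) ≤ 2 * #(bohr Γ ρ) := by
  refine le_trans h ?_
  gcongr
  linarith

lemma rankLoss_mul_regTol_le (L : ℕ) : rankLoss L * regTol L ≤ specTol L := by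
  have h1 : (rankLoss L : ℝ) ≤ Real.exp (rankLoss L) := by
    linarith [Real.add_one_le_exp (rankLoss L : ℝ)]
  have h2 := regTol_pos L
  calc rankLoss L * regTol L ≤ Real.exp (rankLoss L) * regTol L := by gcongr
    _ = Real.exp (-(siftLoss L + 11)) := by
        unfold regTol; rw [← Real.exp_add]; congr 1; ring
    _ ≤ specTol L := by unfold specTol; gcongr; norm_num

variable {A : Finset G} {Γ : Finset (AddChar G ℂ)}

set_option maxHeartbeats 1000000 in
/-- Density increment for a progression-free set which is dense on two Bohr sets. -/
lemma exists_increment_of_dense (e : G ≃+ G) (he : ∀ x, e x = x + x)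
    (hfree : ∀ a ∈ A, ∀ b ∈ A, ∀ c ∈ A, a + c = b + b → a = b) (L D : ℕ) {ω ω₁ : ℝ}
    (hω₁ : ω₁ = regTol L / (100 * (D + 1))) (hω0 : 0 < ω)
    (hω : ω * (2 * smoothSteps L + 4) ≤ ω₁) (hD : #Γ + rankLoss L ≤ D) {ρ₁ ρ₂ : ℝ} (hρ₂ : 0 < ρ₂)
    (hρ₁₂ : ρ₂ ≤ ω * ρ₁) (hρ₁2 : ρ₁ ≤ 2) (hreg₁ : RegAt Γ ω₁ (regTol L) ρ₁)
    (hreg₂ : RegAt Γ ω₁ (regTol L) ρ₂) (x : G) {α : ℝ}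
    (hα : α * #(bohr Γ ρ₁) = #{t ∈ bohr Γ ρ₁ | x + t ∈ A}) (hαL : Real.exp (-L) ≤ α)
    (hα₂ : Real.exp (-L) * #(bohr Γ ρ₂) ≤ #{t ∈ bohr Γ ρ₂ | x + t ∈ A})
    (hbig : 8 * Real.exp (2 * L) ≤ #(bohr Γ ρ₁)) :
    ∃ (Γ' : Finset (AddChar G ℂ)) (ρ' : ℝ) (y : G), #Γ' ≤ #Γ + rankLoss L ∧
      (ω / 2) ^ 4 * ρ₂ ≤ ρ' ∧ ρ' ≤ ρ₂ ∧ RegAt Γ' ω₁ (regTol L) ρ' ∧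
      21 / 20 * α * #(bohr Γ' ρ') ≤ #{t ∈ bohr Γ' ρ' | y + t ∈ A} := by
  classical
  have hκ0 := regTol_pos L
  have hκ1 := regTol_le_one L
  have hω₁0 : 0 < ω₁ := by rw [hω₁]; positivity
  have hω₁κ : ω₁ * (100 * (D + 1)) ≤ regTol L := by
    rw [hω₁, div_mul_cancel₀ _ (by positivity)]
  have hω₁le : ω₁ ≤ regTol L / 100 := by
    rw [hω₁]
    gcongr
    have : (0 : ℝ) ≤ D := by positivity
    linarith
  have hr : (1 : ℝ) ≤ smoothSteps L := by exact_mod_cast smoothSteps_pos L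
  have hω6 : 6 * ω ≤ ω₁ := by nlinarith
  have hω1 : ω ≤ 1 := by linarith
  set H := halve e Γ with hH
  have hHΓ : #H ≤ #Γ := card_halve_le e Γ
  have hHD : #H ≤ D := by omega
  have step : ∀ Γ' : Finset (AddChar G ℂ), #Γ' ≤ D → ∀ ρ : ℝ, 0 < ρ →
      ∃ ρ', 0 < ρ' ∧ ω / 2 * ρ ≤ ρ' ∧ ρ' ≤ ω * ρ ∧ RegAt Γ' ω₁ (regTol L) ρ' := by
    intro Γ' hΓ' ρ hρ
    obtain ⟨ρ', h1, h2, h3⟩ := exists_regAt Γ' hΓ' hκ0 hκ1 hω₁0 hω₁κ (mul_pos hω0 hρ)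
    exact ⟨ρ', by have := mul_pos hω0 hρ; linarith, by linarith, h2, h3⟩
  obtain ⟨ρw, hw0, hw1, hw2, hregw⟩ := step H hHD ρ₂ hρ₂
  obtain ⟨ρu, hu0, hu1, hu2, hregu⟩ := step H hHD ρw hw0
  obtain ⟨ρv, hv0, hv1, hv2, hregv⟩ := step H hHD ρu hu0
  have hρ₁0 : 0 < ρ₁ := by
    by_contra! h
    nlinarith
  have small : ∀ {σ τ : ℝ}, 0 < τ → σ ≤ ω * τ → 6 * σ ≤ ω₁ * τ ∧ σ ≤ τ := by
    intro σ τ hτ h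
    exact ⟨by nlinarith, by nlinarith⟩
  obtain ⟨s₂, s₂'⟩ := small hρ₁0 hρ₁₂
  obtain ⟨sw, sw'⟩ := small hρ₂ hw2
  obtain ⟨su, su'⟩ := small hw0 hu2
  obtain ⟨sv, sv'⟩ := small hu0 hv2
  have hle : ∀ {τ : ℝ}, 0 < τ → τ ≤ (1 + ω₁) * τ := fun h => by nlinarith
  set A₁ : Finset G := {t ∈ bohr Γ ρ₁ | x + t ∈ A} with hA₁
  set A₂ : Finset G := {t ∈ bohr Γ ρ₂ | x + t ∈ A} with hA₂
  have hC : ∀ c ∈ A₂.image e, ∃ a ∈ A₂, c = a + a ∧ c ∈ bohr H ρ₂ := by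
    intro c hc
    obtain ⟨a, ha, rfl⟩ := mem_image.1 hc
    exact ⟨a, ha, he a, (map_mem_bohr_halve e).2 (mem_filter.1 ha).1⟩
  have hB₂ : (0 : ℝ) < #(bohr Γ ρ₂) := by exact_mod_cast (bohr_nonempty hρ₂.le).card_pos
  have hA₂0 : A₂.Nonempty := by
    rw [← card_pos]
    have : (0 : ℝ) < #A₂ := lt_of_lt_of_le (by positivity) hα₂
    exact_mod_cast this
  have hcC : #(A₂.image e) = #A₂ := card_image_of_injective _ e.injective
  have hdouble : ∀ {σ : ℝ} {t : G}, t ∈ bohr H σ → t ∈ bohr Γ (2 * σ) :=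
    fun h => mem_bohr_of_halve e he h
  obtain ⟨Λ, hΛ, hinc⟩ := exists_density_increment (A := A₁) (B := bohr Γ ρ₁)
    (B' := bohr Γ ((1 + ω₁) * ρ₁)) (C := A₂.image e) (E := bohr H ((1 + ω₁) * ρ₂))
    (W := bohr H ρw) (W' := bohr H ((1 + ω₁) * ρw)) (U := bohr H ρu)
    (U' := bohr H ((1 + ω₁) * ρu)) (U₂ := bohr H ρv) (U₂' := bohr H ((1 + ω₁) * ρv)) L
    (filter_subset _ _) (bohr_mono (hle hρ₁0)) hα hαL hreg₁
    (by
      have h1 : Real.exp (-L) ^ 2 ≤ α ^ 2 := by gcongr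
      have h2 : Real.exp (-L) ^ 2 * (8 * Real.exp (2 * L)) = 8 := by
        rw [← Real.exp_nat_mul, mul_left_comm, ← Real.exp_add]
        have : ((2 : ℕ) : ℝ) * -(L : ℝ) + 2 * L = 0 := by push_cast; ring
        rw [this, Real.exp_zero, mul_one]
      calc (8 : ℝ) = Real.exp (-L) ^ 2 * (8 * Real.exp (2 * L)) := h2.symm
        _ ≤ α ^ 2 * #(bohr Γ ρ₁) := by gcongr)
    (bohr_nonempty hw0.le) (fun w hw => neg_mem_bohr hw)
    (fun w hw w' hw' b hb =>
      bohr_mono (by linarith) (add_mem_bohr hb (hdouble (sub_mem_bohr hw hw'))))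
    (by
      intro c hc
      obtain ⟨a, ha, rfl, -⟩ := hC c hc
      rw [conv_ind_eq]
      have : #{s ∈ A₁ | a + a - s ∈ A₁} ≤ 1 := by
        refine (card_le_card (t := {a}) fun s hs => ?_).trans (card_singleton a).le
        obtain ⟨h1, h2⟩ := mem_filter.1 hs
        have := hfree _ (mem_filter.1 h1).2 _ (mem_filter.1 ha).2 _ (mem_filter.1 h2).2 (by abel)
        simpa using this
      exact_mod_cast this)
    (by
      intro c hc b hb
      obtain ⟨a, ha, rfl, h⟩ := hC c hc
      exact bohr_mono (by linarith) (sub_mem_bohr (hdouble h) hb))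
    (by
      intro c hc w hw w' hw'
      obtain ⟨a, ha, rfl, h⟩ := hC c hc
      exact bohr_mono (by linarith) (add_mem_bohr (sub_mem_bohr h hw) hw'))
    (hA₂0.image _)
    (by
      refine (RegAt.card_le_two (hreg₂.halve e) hκ1).trans ?_
      rw [card_bohr_halve, hcC, mul_assoc]
      gcongr
      rw [Real.exp_neg, inv_mul_le_iff₀ (Real.exp_pos _)] at hα₂
      exact hα₂)
    (hregw.card_le_two hκ1) (bohr_nonempty hu0.le)
    (fun w hw u hu => bohr_mono (by linarith) (add_mem_bohr hw hu))
    (fun i => bohr H (2 * i * ρu)) (zero_mem_bohr (by simp))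
    (fun i t ht u hu u' hu' => bohr_mono (by push_cast; linarith)
      (sub_mem_bohr (add_mem_bohr ht hu) hu'))
    (fun i hi t ht w hw => by
      refine bohr_mono ?_ (sub_mem_bohr ht hw)
      have hi' : (i : ℝ) ≤ smoothSteps L := by exact_mod_cast hi
      have h1 : 2 * i * ρu ≤ 2 * smoothSteps L * (ω * ρw) := by gcongr
      have h2 : ω * (2 * smoothSteps L + 4) * ρw ≤ ω₁ * ρw := by gcongr
      have h3 : 0 < ω * ρw := by positivity
      nlinarith)
    (hregu.card_le_two hκ1) (bohr_nonempty hv0.le)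
    (fun t ht u hu => bohr_mono (by linarith) (add_mem_bohr ht hu))
    (bohr_mono (hle hv0)) hregv
  have hcardU : #(H ∪ Λ) ≤ #Γ + rankLoss L := (card_union_le _ _).trans (by omega)
  obtain ⟨ρ', h0, h1, h2, hreg'⟩ := step (H ∪ Λ) (hcardU.trans hD) ρv hv0
  obtain ⟨s', s''⟩ := small hv0 h2
  have hρv2 : ρv ≤ 2 := by linarith
  obtain ⟨y, hy⟩ := hinc (bohr (H ∪ Λ) ρ') (by
    intro t ht
    refine ⟨fun u hu => bohr_mono (by linarith)
      (add_mem_bohr hu (bohr_anti subset_union_left ht)), fun l hl => ?_⟩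
    have h3 := mem_bohr.1 ht l (mem_union_right _ hl)
    have h4 := rankLoss_mul_regTol_le L
    have h5 : ‖l t - 1‖ ≤ regTol L / 2 := by
      have : ω * ρv ≤ ω * 2 := by gcongr
      linarith
    calc rankLoss L * ‖l t - 1‖ ≤ rankLoss L * (regTol L / 2) := by gcongr
      _ ≤ specTol L / 2 := by linarith)
  refine ⟨H ∪ Λ, ρ', x + y, hcardU, ?_, by linarith, hreg', hy.trans ?_⟩
  · calc (ω / 2) ^ 4 * ρ₂ = ω / 2 * (ω / 2 * (ω / 2 * (ω / 2 * ρ₂))) := by ring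
      _ ≤ ω / 2 * (ω / 2 * (ω / 2 * ρw)) := by gcongr
      _ ≤ ω / 2 * (ω / 2 * ρu) := by gcongr
      _ ≤ ω / 2 * ρv := by gcongr
      _ ≤ ρ' := h1
  · have : #{t ∈ bohr (H ∪ Λ) ρ' | y + t ∈ A₁} ≤ #{t ∈ bohr (H ∪ Λ) ρ' | x + y + t ∈ A} := by
      refine card_le_card fun t ht => ?_
      obtain ⟨h3, h4⟩ := mem_filter.1 ht
      refine mem_filter.2 ⟨h3, ?_⟩
      rw [add_assoc]
      exact (mem_filter.1 h4).2
    exact_mod_cast this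

/-- One step of the density increment iteration. -/
lemma exists_bohr_increment (e : G ≃+ G) (he : ∀ x, e x = x + x)
    (hfree : ∀ a ∈ A, ∀ b ∈ A, ∀ c ∈ A, a + c = b + b → a = b) (L D : ℕ) {ω ω₁ : ℝ}
    (hω₁ : ω₁ = regTol L / (100 * (D + 1))) (hω0 : 0 < ω)
    (hω : ω * (2 * smoothSteps L + 4) ≤ ω₁) (hD : #Γ + rankLoss L ≤ D) {ρ : ℝ} (hρ : 0 < ρ)
    (hρ2 : ρ ≤ 2) (hreg : RegAt Γ ω₁ (regTol L) ρ) (x : G) {α : ℝ}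
    (hα : α * #(bohr Γ ρ) ≤ #{t ∈ bohr Γ ρ | x + t ∈ A}) (hαL : Real.exp (-L) ≤ 97 / 100 * α)
    (hbig : ∀ ρ₁, ω / 2 * ρ ≤ ρ₁ → 8 * Real.exp (2 * L) ≤ #(bohr Γ ρ₁)) :
    ∃ (Γ' : Finset (AddChar G ℂ)) (ρ' : ℝ) (y : G), #Γ' ≤ #Γ + rankLoss L ∧
      (ω / 2) ^ 6 * ρ ≤ ρ' ∧ ρ' ≤ ρ ∧ RegAt Γ' ω₁ (regTol L) ρ' ∧
      101 / 100 * α * #(bohr Γ' ρ') ≤ #{t ∈ bohr Γ' ρ' | y + t ∈ A} := by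
  have hκ0 := regTol_pos L
  have hκ1 := regTol_le_one L
  have hω₁0 : 0 < ω₁ := by rw [hω₁]; positivity
  have hω₁κ : ω₁ * (100 * (D + 1)) ≤ regTol L := by
    rw [hω₁, div_mul_cancel₀ _ (by positivity)]
  have hω₁le : ω₁ ≤ 1 := by
    refine le_trans ?_ hκ1
    rw [hω₁]
    refine div_le_self hκ0.le ?_
    have : (0 : ℝ) ≤ D := by positivity
    linarith
  have hr : (1 : ℝ) ≤ smoothSteps L := by exact_mod_cast smoothSteps_pos L
  have hωω₁ : ω ≤ ω₁ := by nlinarith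
  have hω1 : ω ≤ 1 := by linarith
  have hωρ : ω * ρ ≤ 1 * ρ := by gcongr
  obtain ⟨ρ₁, h1, h2, hreg₁⟩ := exists_regAt Γ (by omega : #Γ ≤ D) hκ0 hκ1 hω₁0 hω₁κ
    (mul_pos hω0 hρ)
  have hρ₁0 : 0 < ρ₁ := by linarith [mul_pos hω0 hρ]
  obtain ⟨ρ₂, h3, h4, hreg₂⟩ := exists_regAt Γ (by omega : #Γ ≤ D) hκ0 hκ1 hω₁0 hω₁κ
    (mul_pos hω0 hρ₁0)
  have hρ₂0 : 0 < ρ₂ := by linarith [mul_pos hω0 hρ₁0]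
  have hωρ₁ : ω * ρ₁ ≤ 1 * ρ₁ := by gcongr
  have hωρ' : ω * ρ ≤ ω₁ * ρ := by gcongr
  have hα0 : 0 < α := by linarith [Real.exp_pos (-(L : ℝ))]
  have hp2 : (ω / 2) ^ 6 * ρ ≤ (ω / 2) ^ 2 * ρ := by
    gcongr ?_ * ρ
    exact pow_le_pow_of_le_one (by positivity) (by linarith) (by norm_num)
  have hp1 : (ω / 2) ^ 2 * ρ ≤ (ω / 2) ^ 1 * ρ := by
    gcongr ?_ * ρ
    exact pow_le_pow_of_le_one (by positivity) (by linarith) (by norm_num)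
  have hρ₂' : (ω / 2) ^ 2 * ρ ≤ ρ₂ := by
    calc (ω / 2) ^ 2 * ρ = ω * (ω * ρ / 2) / 2 := by ring
      _ ≤ ω * ρ₁ / 2 := by gcongr
      _ ≤ ρ₂ := h3
  have hB₁ : (0 : ℝ) < #(bohr Γ ρ₁) := by exact_mod_cast (bohr_nonempty hρ₁0.le).card_pos
  have hB₂ : (0 : ℝ) < #(bohr Γ ρ₂) := by exact_mod_cast (bohr_nonempty hρ₂0.le).card_pos
  obtain ⟨z, hz⟩ := exists_shift_two_densities (X := bohr Γ ρ) (X' := bohr Γ ((1 + ω₁) * ρ))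
    (Y := bohr Γ ρ₁) (Z := bohr Γ ρ₂) (A := univ.filter fun g => x + g ∈ A) (α := α)
    (κ := regTol L) (bohr_nonempty hρ.le)
    (bohr_mono (by nlinarith)) hreg (by simpa using hα) (bohr_nonempty hρ₁0.le)
    (fun a ha b hb => bohr_mono (by linarith) (add_mem_bohr ha hb)) (bohr_nonempty hρ₂0.le)
    (fun a ha b hb => bohr_mono (by linarith) (add_mem_bohr ha hb))
  simp only [mem_filter, mem_univ, true_and, ← add_assoc] at hz
  set d₁ := (#{t ∈ bohr Γ ρ₁ | x + z + t ∈ A} : ℝ) / #(bohr Γ ρ₁) with hd₁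
  set d₂ := (#{t ∈ bohr Γ ρ₂ | x + z + t ∈ A} : ℝ) / #(bohr Γ ρ₂) with hd₂
  have e₁ : d₁ * #(bohr Γ ρ₁) = #{t ∈ bohr Γ ρ₁ | x + z + t ∈ A} := by
    rw [hd₁, div_mul_cancel₀ _ hB₁.ne']
  have e₂ : d₂ * #(bohr Γ ρ₂) = #{t ∈ bohr Γ ρ₂ | x + z + t ∈ A} := by
    rw [hd₂, div_mul_cancel₀ _ hB₂.ne']
  have hκα := regTol_le L
  by_cases c₁ : 101 / 100 * α ≤ d₁
  · refine ⟨Γ, ρ₁, x + z, by omega, by linarith, by linarith, hreg₁, ?_⟩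
    rw [← e₁]; gcongr
  by_cases c₂ : 101 / 100 * α ≤ d₂
  · refine ⟨Γ, ρ₂, x + z, by omega, by linarith, by linarith, hreg₂, ?_⟩
    rw [← e₂]; gcongr
  push Not at c₁ c₂
  obtain ⟨Γ', ρ', y, g1, g2, g3, g4, g5⟩ := exists_increment_of_dense e he hfree L D hω₁ hω0 hω hD
    hρ₂0 h4 (by linarith) hreg₁ hreg₂ (x + z) e₁ (by linarith)
    (by rw [← e₂]; gcongr; linarith) (hbig ρ₁ (by linarith))
  refine ⟨Γ', ρ', y, g1, ?_, by linarith, g4, le_trans ?_ g5⟩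
  · calc (ω / 2) ^ 6 * ρ = (ω / 2) ^ 4 * ((ω / 2) ^ 2 * ρ) := by ring
      _ ≤ (ω / 2) ^ 4 * ρ₂ := by gcongr
      _ ≤ ρ' := g2
  · gcongr ?_ * _
    linarith

end BohrIncrement

section Iteration

variable {G : Type*} [AddCommGroup G] [Fintype G] [DecidableEq G]

/-- Number of density increments. -/
def numSteps (L : ℕ) : ℕ := 101 * L

/-- Bound for the rank of the Bohr sets in the iteration. -/
def maxRank (L : ℕ) : ℕ := numSteps L * rankLoss L

/-- The radius shrinks by at least `2 ^ (-scaleExp L)` between consecutive nested Bohr sets. -/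
def scaleExp (L : ℕ) : ℕ :=
  8 + (2 * smoothSteps L + 4) + (maxRank L + 1) + 2 * (rankLoss L + siftLoss L + 11)

lemma exp_nat_le (n : ℕ) : Real.exp n ≤ 2 ^ (2 * n) := by
  rw [← Real.exp_one_pow, pow_mul]
  have := Real.exp_one_lt_d9
  gcongr
  linarith

lemma scale_le (L : ℕ) : 2 * (1 / 2 : ℝ) ^ scaleExp L * (2 * smoothSteps L + 4) ≤
    regTol L / (100 * (maxRank L + 1)) := by
  have h1 : (2 * smoothSteps L + 4 : ℝ) ≤ 2 ^ (2 * smoothSteps L + 4) := by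
    exact_mod_cast (Nat.lt_two_pow_self (n := 2 * smoothSteps L + 4)).le
  have h2 : (maxRank L + 1 : ℝ) ≤ 2 ^ (maxRank L + 1) := by
    exact_mod_cast (Nat.lt_two_pow_self (n := maxRank L + 1)).le
  have h3 : (regTol L)⁻¹ ≤ 2 ^ (2 * (rankLoss L + siftLoss L + 11)) := by
    rw [regTol, Real.exp_neg, inv_inv]
    exact_mod_cast exp_nat_le (rankLoss L + siftLoss L + 11)
  have h4 : (200 : ℝ) ≤ 2 ^ 8 := by norm_num
  have h5 : 200 * (2 * smoothSteps L + 4) * (maxRank L + 1) * (regTol L)⁻¹ ≤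
      (2 : ℝ) ^ scaleExp L := by
    rw [scaleExp, pow_add, pow_add, pow_add]
    have := regTol_pos L
    gcongr
  have h6 := regTol_pos L
  rw [one_div, inv_pow, le_div_iff₀ (by positivity), mul_right_comm, mul_right_comm,
    ← div_eq_mul_inv, div_mul_eq_mul_div, div_mul_eq_mul_div, div_le_iff₀ (by positivity)]
  rw [← div_eq_mul_inv, div_le_iff₀ h6] at h5
  linarith

lemma bohr_empty (ρ : ℝ) : bohr (∅ : Finset (AddChar G ℂ)) ρ = univ := by
  ext x; simp [mem_bohr]

variable {A : Finset G}

lemma exists_iterated_increment (e : G ≃+ G) (he : ∀ x, e x = x + x)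
    (hfree : ∀ a ∈ A, ∀ b ∈ A, ∀ c ∈ A, a + c = b + b → a = b) (L : ℕ) {α : ℝ}
    (hα : α * Fintype.card G ≤ #A) (hαL : Real.exp (-L) ≤ 97 / 100 * α)
    (hbig : (81 : ℝ) ^ (maxRank L * (scaleExp L * (6 * numSteps L))) * (8 * Real.exp (2 * L)) ≤
      Fintype.card G) (j : ℕ) (hj : j ≤ numSteps L) :
    ∃ (Γ : Finset (AddChar G ℂ)) (ρ : ℝ) (x : G), #Γ ≤ j * rankLoss L ∧
      2 * (1 / 2) ^ (scaleExp L * (6 * j)) ≤ ρ ∧ ρ ≤ 2 ∧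
      RegAt Γ (regTol L / (100 * (maxRank L + 1))) (regTol L) ρ ∧
      (101 / 100) ^ j * α * #(bohr Γ ρ) ≤ #{t ∈ bohr Γ ρ | x + t ∈ A} := by
  induction j with
  | zero =>
    refine ⟨∅, 2, 0, by simp, by simp, le_rfl, ?_, by simpa [bohr_empty] using hα⟩
    simp only [RegAt, bohr_empty]
    have := regTol_pos L
    nlinarith [(Nat.cast_nonneg #(univ : Finset G) : (0 : ℝ) ≤ _)]
  | succ j ih =>
    obtain ⟨Γ, ρ, x, h1, h2, h3, h4, h5⟩ := ih (by omega)
    have hα0 : 0 < α := by linarith [Real.exp_pos (-(L : ℝ))]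
    have hrank : #Γ + rankLoss L ≤ maxRank L := by
      calc #Γ + rankLoss L ≤ j * rankLoss L + rankLoss L := by omega
        _ = (j + 1) * rankLoss L := by ring
        _ ≤ maxRank L := Nat.mul_le_mul_right _ hj
    have hω2 : (2 * (1 / 2 : ℝ) ^ scaleExp L) / 2 = (1 / 2) ^ scaleExp L := by ring
    have hpow : (α : ℝ) ≤ (101 / 100) ^ j * α :=
      le_mul_of_one_le_left hα0.le (one_le_pow₀ (by norm_num))
    obtain ⟨Γ', ρ', y, g1, g2, g3, g4, g5⟩ := exists_bohr_increment e he hfree L (maxRank L) rfl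
      (by positivity) (scale_le L) hrank (lt_of_lt_of_le (by positivity) h2) h3 h4 x h5
      (hαL.trans (by gcongr)) (by
        intro ρ₁ hρ₁
        have hρ₁' : 2 * (1 / 2 : ℝ) ^ (scaleExp L * (6 * numSteps L)) ≤ ρ₁ := by
          refine le_trans ?_ hρ₁
          rw [hω2]
          calc 2 * (1 / 2 : ℝ) ^ (scaleExp L * (6 * numSteps L))
              ≤ 2 * (1 / 2) ^ (scaleExp L + scaleExp L * (6 * j)) := by
                gcongr ?_ * ?_
                refine pow_le_pow_of_le_one (by norm_num) (by norm_num) ?_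
                nlinarith
            _ = (1 / 2) ^ scaleExp L * (2 * (1 / 2) ^ (scaleExp L * (6 * j))) := by
                rw [pow_add]; ring
            _ ≤ _ := by gcongr
        have k1 : (Fintype.card G : ℝ) ≤ 81 ^ (#Γ * (scaleExp L * (6 * numSteps L))) *
            #(bohr Γ (2 * (1 / 2) ^ (scaleExp L * (6 * numSteps L)))) := by
          exact_mod_cast card_le_bohr Γ (scaleExp L * (6 * numSteps L))
        have k2 : (Fintype.card G : ℝ) ≤ 81 ^ (maxRank L * (scaleExp L * (6 * numSteps L))) *
            #(bohr Γ ρ₁) := by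
          refine k1.trans ?_
          gcongr
          · norm_num
          · omega
          · exact bohr_mono hρ₁'
        exact le_of_mul_le_mul_left (hbig.trans k2) (by positivity))
    refine ⟨Γ', ρ', y, by nlinarith, le_trans ?_ g2, by linarith, g4, ?_⟩
    · rw [hω2, ← pow_mul]
      calc 2 * (1 / 2 : ℝ) ^ (scaleExp L * (6 * (j + 1)))
          = (1 / 2) ^ (scaleExp L * 6) * (2 * (1 / 2) ^ (scaleExp L * (6 * j))) := by
            rw [mul_add, mul_add, pow_add]; ring
        _ ≤ _ := by gcongr
    · refine le_of_eq_of_le ?_ g5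
      rw [pow_succ]; ring

/-- A progression-free set of density at least `exp (-L)` lives in a small group. -/
lemma card_lt_of_free (e : G ≃+ G) (he : ∀ x, e x = x + x)
    (hfree : ∀ a ∈ A, ∀ b ∈ A, ∀ c ∈ A, a + c = b + b → a = b) (L : ℕ) {α : ℝ}
    (hα : α * Fintype.card G ≤ #A) (hαL : Real.exp (-L) ≤ 97 / 100 * α) :
    (Fintype.card G : ℝ) <
      81 ^ (maxRank L * (scaleExp L * (6 * numSteps L))) * (8 * Real.exp (2 * L)) := by
  by_contra! hbig
  obtain ⟨Γ, ρ, x, -, h2, -, -, h5⟩ :=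
    exists_iterated_increment e he hfree L hα hαL hbig (numSteps L) le_rfl
  have hρ : 0 < ρ := lt_of_lt_of_le (by positivity) h2
  have hB : (0 : ℝ) < #(bohr Γ ρ) := by exact_mod_cast (bohr_nonempty hρ.le).card_pos
  have h6 : (#{t ∈ bohr Γ ρ | x + t ∈ A} : ℝ) ≤ 1 * #(bohr Γ ρ) := by
    rw [one_mul]; exact_mod_cast card_filter_le _ _
  have h7 := le_of_mul_le_mul_right (h5.trans h6) hB
  have h8 : Real.exp L ≤ (101 / 100) ^ numSteps L := by
    rw [numSteps, pow_mul, ← Real.exp_one_pow]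
    have := Real.exp_one_lt_d9
    gcongr
    refine this.le.trans ?_
    norm_num
  have hα0 : 0 < α := by linarith [Real.exp_pos (-(L : ℝ))]
  have h9 : Real.exp L * Real.exp (-L) ≤ Real.exp L * (97 / 100 * α) := by gcongr
  rw [← Real.exp_add, add_neg_cancel, Real.exp_zero] at h9
  have h10 : Real.exp L * α ≤ 1 := le_trans (by gcongr) h7
  linarith

end Iteration

section PolynomialGrowth

/-- `f` is bounded by a polynomial. -/
def PolyBdd (f : ℕ → ℕ) : Prop := ∃ K m : ℕ, ∀ n, f n ≤ K * (n + 1) ^ m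

lemma PolyBdd.const (c : ℕ) : PolyBdd fun _ => c := ⟨c, 0, by simp⟩

lemma PolyBdd.id : PolyBdd fun n => n := ⟨1, 1, by simp⟩

lemma PolyBdd.add {f g : ℕ → ℕ} (hf : PolyBdd f) (hg : PolyBdd g) :
    PolyBdd fun n => f n + g n := by
  obtain ⟨K, m, h⟩ := hf
  obtain ⟨K', m', h'⟩ := hg
  refine ⟨K + K', m + m', fun n => ?_⟩
  have h1 : (n + 1) ^ m ≤ (n + 1) ^ (m + m') := Nat.pow_le_pow_right (by omega) (by omega)
  have h2 : (n + 1) ^ m' ≤ (n + 1) ^ (m + m') := Nat.pow_le_pow_right (by omega) (by omega)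
  rw [add_mul]
  exact add_le_add ((h n).trans (by gcongr)) ((h' n).trans (by gcongr))

lemma PolyBdd.mul {f g : ℕ → ℕ} (hf : PolyBdd f) (hg : PolyBdd g) :
    PolyBdd fun n => f n * g n := by
  obtain ⟨K, m, h⟩ := hf
  obtain ⟨K', m', h'⟩ := hg
  refine ⟨K * K', m + m', fun n => ?_⟩
  calc f n * g n ≤ (K * (n + 1) ^ m) * (K' * (n + 1) ^ m') := Nat.mul_le_mul (h n) (h' n)
    _ = K * K' * (n + 1) ^ (m + m') := by rw [pow_add]; ring

/-- A polynomial bound for the logarithm of the size of the group. -/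
def logBound (L : ℕ) : ℕ :=
  5 * (maxRank L * (scaleExp L * (6 * numSteps L))) + 3 + 2 * L

lemma polyBdd_logBound : PolyBdd logBound := by
  have c := PolyBdd.const
  have hX : PolyBdd siftLoss := (PolyBdd.id.mul ((c 8).mul (((c 4).mul .id).add (c 18)))).add (c 1)
  have hr : PolyBdd smoothSteps := hX.add (c 9)
  have hr' : PolyBdd fun L => (800 * smoothSteps L) ^ 2 := by
    simp only [sq]
    exact ((c 800).mul hr).mul ((c 800).mul hr)
  have hk : PolyBdd sampleSize := ((c 2).mul hr').mul ((hX.add (c 10)).add hr)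
  have hP : PolyBdd rankLoss := (c 8).mul (((hX.add (c 1)).mul hk).add (c 3))
  have hJ : PolyBdd numSteps := (c 101).mul .id
  have hD : PolyBdd maxRank := hJ.mul hP
  have hs : PolyBdd scaleExp := (((c 8).add (((c 2).mul hr).add (c 4))).add (hD.add (c 1))).add
    ((c 2).mul ((hP.add hX).add (c 11)))
  exact (((c 5).mul (hD.mul (hs.mul ((c 6).mul hJ)))).add (c 3)).add ((c 2).mul .id)

lemma le_exp_logBound (L : ℕ) :
    (81 : ℝ) ^ (maxRank L * (scaleExp L * (6 * numSteps L))) * (8 * Real.exp (2 * L)) ≤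
      Real.exp (logBound L) := by
  have h1 : (81 : ℝ) ≤ Real.exp (5 : ℕ) := le_trans (by norm_num) (exp_nat_ge 5)
  have h2 : (8 : ℝ) ≤ Real.exp (3 : ℕ) := le_trans (by norm_num) (exp_nat_ge 3)
  have h3 : Real.exp (logBound L) =
      Real.exp (5 : ℕ) ^ (maxRank L * (scaleExp L * (6 * numSteps L))) *
        (Real.exp (3 : ℕ) * Real.exp (2 * L)) := by
    rw [← Real.exp_nat_mul, ← Real.exp_add, ← Real.exp_add]
    congr 1
    unfold logBound
    push_cast
    ring
  rw [h3]
  gcongr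

lemma eventually_logBound_le :
    ∀ᶠ x : ℝ in Filter.atTop, (logBound ⌈2 * Real.log x⌉₊ : ℝ) ≤ x := by
  obtain ⟨K, m, h⟩ := polyBdd_logBound
  have h1 := (Real.isLittleO_pow_log_id_atTop (n := m)).def
    (c := ((K + 1) * 4 ^ m : ℝ)⁻¹) (by positivity)
  filter_upwards [h1, Filter.eventually_ge_atTop 1,
    Real.tendsto_log_atTop.eventually_ge_atTop 1] with x hx hx1 hlog
  rw [Real.norm_of_nonneg (by positivity), id, Real.norm_of_nonneg (by positivity),
    inv_mul_eq_div, le_div_iff₀ (by positivity)] at hx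
  have h2 : (⌈2 * Real.log x⌉₊ : ℝ) + 1 ≤ 4 * Real.log x := by
    have := Nat.ceil_lt_add_one (show 0 ≤ 2 * Real.log x by linarith)
    linarith
  calc (logBound ⌈2 * Real.log x⌉₊ : ℝ) ≤ K * ((⌈2 * Real.log x⌉₊ : ℝ) + 1) ^ m := by
        exact_mod_cast h _
    _ ≤ (K + 1) * (4 * Real.log x) ^ m := by gcongr; linarith
    _ = Real.log x ^ m * ((K + 1) * 4 ^ m) := by rw [mul_pow]; ring
    _ ≤ x := hx

end PolynomialGrowth

section Transfer

lemma nat_eq_of_zmod_eq {N x y : ℕ} (hx : x ≤ 2 * N) (hy : y ≤ 2 * N)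
    (h : (x : ZMod (2 * N + 1)) = y) : x = y := by
  rw [ZMod.natCast_eq_natCast_iff', Nat.mod_eq_of_lt (by omega), Nat.mod_eq_of_lt (by omega)] at h
  exact h

lemma exists_doubling (N : ℕ) :
    ∃ e : ZMod (2 * N + 1) ≃+ ZMod (2 * N + 1), ∀ x, e x = x + x := by
  have hinj : Function.Injective
      (AddMonoidHom.id (ZMod (2 * N + 1)) + AddMonoidHom.id (ZMod (2 * N + 1))) := by
    intro x y h
    simp only [AddMonoidHom.add_apply, AddMonoidHom.id_apply] at h
    have h0 : (2 * N + 1 : ZMod (2 * N + 1)) = 0 := by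
      exact_mod_cast ZMod.natCast_self (2 * N + 1)
    linear_combination (N + 1 : ZMod (2 * N + 1)) * h - (x - y) * h0
  exact ⟨AddEquiv.ofBijective _ (Finite.injective_iff_bijective.1 hinj), fun x => rfl⟩

/-- Progression-free subsets of `{1, …, N}` have density at most `exp (-L)` unless `N` is small. -/
lemma log_lt_of_free {N : ℕ} (hN : 0 < N) {S : Finset ℕ} (hS : S ⊆ Icc 1 N)
    (hfree : ¬ ∃ x d : ℕ, d ≠ 0 ∧ x ∈ S ∧ x + d ∈ S ∧ x + 2 * d ∈ S) (L : ℕ)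
    (hL : 4 * N * Real.exp (-L) < #S) : Real.log N < logBound L := by
  obtain ⟨e, he⟩ := exists_doubling N
  have hle : ∀ x ∈ S, x ≤ N := fun x hx => (mem_Icc.1 (hS hx)).2
  set A : Finset (ZMod (2 * N + 1)) := S.image Nat.cast with hA
  have hcard : #A = #S := card_image_of_injOn fun x hx y hy h =>
    nat_eq_of_zmod_eq (by linarith [hle x hx]) (by linarith [hle y hy]) h
  have hfree' : ∀ a ∈ A, ∀ b ∈ A, ∀ c ∈ A, a + c = b + b → a = b := by
    intro a ha b hb c hc h
    obtain ⟨x, hx, rfl⟩ := mem_image.1 ha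
    obtain ⟨y, hy, rfl⟩ := mem_image.1 hb
    obtain ⟨z, hz, rfl⟩ := mem_image.1 hc
    have hx' := hle x hx
    have hy' := hle y hy
    have hz' := hle z hz
    have h' : x + z = y + y := nat_eq_of_zmod_eq (N := N) (by omega) (by omega) (by
      push_cast; exact h)
    congr 1
    rcases lt_trichotomy x y with hxy | hxy | hxy
    · refine (hfree ⟨x, y - x, by omega, hx, ?_, ?_⟩).elim
      · rwa [show x + (y - x) = y by omega]
      · rwa [show x + 2 * (y - x) = z by omega]
    · exact hxy
    · refine (hfree ⟨z, y - z, by omega, hz, ?_, ?_⟩).elim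
      · rwa [show z + (y - z) = y by omega]
      · rwa [show z + 2 * (y - z) = x by omega]
  have hN1 : (1 : ℝ) ≤ N := by exact_mod_cast hN
  have hG : (Fintype.card (ZMod (2 * N + 1)) : ℝ) = 2 * N + 1 := by
    rw [ZMod.card]; push_cast; ring
  have hlt := card_lt_of_free e he hfree' L (α := #S / (2 * N + 1))
    (by rw [hG, hcard, div_mul_cancel₀ _ (by positivity)]) (by
      rw [← mul_div_assoc, le_div_iff₀ (by positivity)]
      have := Real.exp_pos (-(L : ℝ))
      nlinarith)
  rw [hG] at hlt
  rw [Real.log_lt_iff_lt_exp (by positivity)]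
  linarith [le_exp_logBound L]

end Transfer

end KelleyMeka

/-- Bloom–Sisask: progression-free subsets of `{1,...,N}` have size at most
`C · N · (log N)^{−1−ε}` for some `ε > 0`. -/
theorem bloom_sisask :
    ∃ ε C : ℝ, 0 < ε ∧ 0 < C ∧ ∃ N₀ : ℕ, ∀ N : ℕ, N₀ < N →
      ∀ S : Finset ℕ, S ⊆ Finset.Icc 1 N →
        (¬ ∃ x d : ℕ, d ≠ 0 ∧ x ∈ S ∧ x + d ∈ S ∧ x + 2 * d ∈ S) →
        (S.card : ℝ) ≤ C * (N : ℝ) * Real.log N ^ (-1 - ε) := by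
  have htend := Real.tendsto_log_atTop.comp tendsto_natCast_atTop_atTop
  obtain ⟨N₀, hN₀⟩ := Filter.eventually_atTop.1
    ((htend.eventually KelleyMeka.eventually_logBound_le).and (htend.eventually_ge_atTop 1))
  refine ⟨1, 4, one_pos, by norm_num, N₀, fun N hN S hS hfree => ?_⟩
  obtain ⟨h1, h2⟩ := hN₀ N hN.le
  simp only [Function.comp_apply] at h1 h2
  by_contra! hlt
  refine absurd (KelleyMeka.log_lt_of_free (by omega) hS hfree ⌈2 * Real.log (Real.log N)⌉₊ ?_)
    h1.not_gt
  refine lt_of_le_of_lt ?_ hlt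
  gcongr
  rw [Real.rpow_def_of_pos (by linarith)]
  gcongr
  have := Nat.le_ceil (2 * Real.log (Real.log N))
  linarith
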